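/- arXiv:2502.02778 — 2 statements merged into one kernel-verified Lean document; each statement's English description precedes it below -/
import Mathlib

section
/- Let D be a dendrite whose set of end points E(D) is closed in D. Then every arc [a,b] ⊆ D with a ≠ b contains a free arc, i.e., there exist u,v ∈ [a,b] with u ≠ v such that (u,v) is an open subset of D. -/
open TopologicalSpace Topology

/-- The set of end points of a space: points `p` whose complement `D \ {p}`
is connected. -/
def endPoints (D : Type*) [TopologicalSpace D] : Set D :=
  {p : D | IsConnected ({p}ᶜ : Set D)}

open Set Filter

section PathConnected

variable {X : Type*} [MetricSpace X]

/-- Two points are `ε`-linked if they lie in a connected set of diameter at most `ε`. -/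
def Linked (ε : ℝ) (x y : X) : Prop :=
  ∃ S : Set X, IsPreconnected S ∧ x ∈ S ∧ y ∈ S ∧ ∀ z ∈ S, ∀ w ∈ S, dist z w ≤ ε

theorem Linked.symm {ε : ℝ} {x y : X} (h : Linked ε x y) : Linked ε y x := by
  obtain ⟨S, hS, hx, hy, hd⟩ := h
  exact ⟨S, hS, hy, hx, hd⟩

theorem Linked.dist_le {ε : ℝ} {x y : X} (h : Linked ε x y) : dist x y ≤ ε := by
  obtain ⟨S, -, hx, hy, hd⟩ := h
  exact hd x hx y hy

theorem Linked.refl {ε : ℝ} (hε : 0 ≤ ε) (x : X) : Linked ε x x :=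
  ⟨{x}, isPreconnected_singleton, rfl, rfl, by simpa using hε⟩

theorem eventually_linked [LocallyConnectedSpace X] {ε : ℝ} (hε : 0 < ε) (x : X) :
    ∀ᶠ y in 𝓝 x, Linked ε x y := by
  obtain ⟨V, ⟨hVo, hxV, hVc⟩, hV⟩ :=
    (LocallyConnectedSpace.open_connected_basis x).mem_iff.1 (Metric.ball_mem_nhds x (half_pos hε))
  filter_upwards [hVo.mem_nhds hxV] with y hy
  refine ⟨V, hVc.isPreconnected, hxV, hy, fun z hz w hw => ?_⟩
  have h1 := Metric.mem_ball.1 (hV hz)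
  have h2 := Metric.mem_ball'.1 (hV hw)
  linarith [dist_triangle z x w]

/-- Any two points of a connected set are joined in it by a finite chain of linked points, here
an eventually constant sequence. -/
theorem IsPreconnected.exists_linked_chain [LocallyConnectedSpace X] {S : Set X}
    (hS : IsPreconnected S) {ε : ℝ} (hε : 0 < ε) {x y : X} (hx : x ∈ S) (hy : y ∈ S) :
    ∃ (c : ℕ → X) (n : ℕ), c 0 = x ∧ (∀ j, n ≤ j → c j = y) ∧ (∀ j, c j ∈ S) ∧
      ∀ j, Linked ε (c j) (c (j + 1)) := by
  refine hS.induction₂' (fun x y => ∃ (c : ℕ → X) (n : ℕ), c 0 = x ∧ (∀ j, n ≤ j → c j = y) ∧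
    (∀ j, c j ∈ S) ∧ ∀ j, Linked ε (c j) (c (j + 1))) ?_ ?_ hx hy
  · have key : ∀ x ∈ S, ∀ y ∈ S, Linked ε x y → ∃ (c : ℕ → X) (n : ℕ), c 0 = x ∧
        (∀ j, n ≤ j → c j = y) ∧ (∀ j, c j ∈ S) ∧ ∀ j, Linked ε (c j) (c (j + 1)) := by
      intro x hx y hy h
      refine ⟨fun j => if j = 0 then x else y, 1, by simp, fun j hj => ?_, fun j => ?_, fun j => ?_⟩
      · have : j ≠ 0 := by omega
        simp [this]
      · dsimp only
        split_ifs <;> assumption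
      · by_cases hj : j = 0
        · simpa [hj] using h
        · simpa [hj] using Linked.refl hε.le y
    intro x hx
    filter_upwards [mem_nhdsWithin_of_mem_nhds (eventually_linked hε x), self_mem_nhdsWithin]
      with y h hy
    exact ⟨key x hx y hy h, key y hy x hx h.symm⟩
  · rintro x y z - - - ⟨c, n, hc0, hcn, hcS, hc⟩ ⟨d, m, hd0, hdm, hdS, hd⟩
    refine ⟨fun j => if j ≤ n then c j else d (j - n), n + m, by simpa using hc0, fun j hj => ?_,
      fun j => ?_, fun j => ?_⟩
    · dsimp only
      split_ifs with h
      · have hm : m = 0 := by omega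
        rw [hcn j (by omega), ← hd0]
        exact hdm 0 hm.le
      · exact hdm _ (by omega)
    · dsimp only
      split_ifs
      exacts [hcS _, hdS _]
    · dsimp only
      split_ifs with h1 h2 h2
      · exact hc j
      · have hj : j = n := by omega
        subst hj
        have := hd 0
        rw [hd0, ← hcn j le_rfl] at this
        simpa using this
      · omega
      · have := hd (j - n)
        rwa [show j - n + 1 = j + 1 - n by omega] at this

/-- Refinement of a chain: every link is subdivided into the same number `N` of finer links. -/
theorem exists_linked_refinement [LocallyConnectedSpace X] {ε δ : ℝ} (hδ : 0 < δ) {a b : X}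
    {K : ℕ} {f : ℕ → X} (h0 : f 0 = a) (hK : ∀ m, K ≤ m → f m = b)
    (hf : ∀ m, Linked ε (f m) (f (m + 1))) :
    ∃ (N : ℕ) (g : ℕ → X), 0 < N ∧ g 0 = a ∧ (∀ m, K * N ≤ m → g m = b) ∧
      (∀ m, Linked δ (g m) (g (m + 1))) ∧ ∀ m, dist (f (m / N)) (g m) ≤ ε := by
  have hchain : ∀ m, ∃ (c : ℕ → X) (n : ℕ), c 0 = f m ∧ (∀ j, n ≤ j → c j = f (m + 1)) ∧
      (∀ j, dist (f m) (c j) ≤ ε) ∧ ∀ j, Linked δ (c j) (c (j + 1)) := by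
    intro m
    obtain ⟨S, hS, hx, hy, hd⟩ := hf m
    obtain ⟨c, n, hc0, hcn, hcS, hc⟩ := hS.exists_linked_chain hδ hx hy
    exact ⟨c, n, hc0, hcn, fun j => hd _ hx _ (hcS j), hc⟩
  choose c n hc0 hcn hcd hc using hchain
  let N := (Finset.range K).sup n + 1
  have hN : 0 < N := Nat.succ_pos _
  let c' : ℕ → ℕ → X := fun m => if m < K then c m else fun _ => b
  have hc'0 : ∀ m, c' m 0 = f m := by
    intro m
    by_cases h : m < K
    · simp [c', h, hc0]
    · simp [c', h, hK m (by omega)]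
  have hc'N : ∀ m, c' m N = f (m + 1) := by
    intro m
    by_cases h : m < K
    · have : n m ≤ (Finset.range K).sup n := Finset.le_sup (f := n) (Finset.mem_range.2 h)
      simp only [c', h, if_true]
      exact hcn m N (by omega)
    · simp [c', h, hK (m + 1) (by omega)]
  have hc'd : ∀ m j, dist (f m) (c' m j) ≤ ε := by
    intro m j
    by_cases h : m < K
    · simpa [c', h] using hcd m j
    · have := (hf m).dist_le
      rw [hK (m + 1) (by omega)] at this
      simpa [c', h] using this
  have hc' : ∀ m j, Linked δ (c' m j) (c' m (j + 1)) := by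
    intro m j
    by_cases h : m < K
    · simpa [c', h] using hc m j
    · simpa [c', h] using Linked.refl hδ.le b
  refine ⟨N, fun k => c' (k / N) (k % N), hN, by simp [hc'0, h0], fun m hm => ?_, fun m => ?_,
    fun m => hc'd _ _⟩
  · have : ¬ m / N < K := by
      rw [not_lt]
      exact (Nat.le_div_iff_mul_le hN).2 hm
    simp [c', this]
  · dsimp only
    have hlink := hc' (m / N) (m % N)
    have hlt := Nat.mod_lt m hN
    have hdm := Nat.div_add_mod m N
    rcases (Nat.succ_le_of_lt hlt).eq_or_lt with h | h
    · have hm : m + 1 = N * (m / N + 1) := by rw [mul_add]; omega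
      have h1 : (m + 1) / N = m / N + 1 := by rw [hm, Nat.mul_div_cancel_left _ hN]
      have h2 : (m + 1) % N = 0 := by rw [hm, Nat.mul_mod_right]
      rw [h1, h2, hc'0, ← hc'N]
      rwa [show m % N + 1 = N from h] at hlink
    · have hm : m + 1 = (m % N + 1) + N * (m / N) := by omega
      have h1 : (m + 1) / N = m / N := by
        rw [hm, Nat.add_mul_div_left _ _ hN, Nat.div_eq_of_lt h, zero_add]
      have h2 : (m + 1) % N = m % N + 1 := by
        rw [hm, Nat.add_mul_mod_self_left, Nat.mod_eq_of_lt h]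
      rwa [h1, h2]

theorem exists_continuous_path [CompleteSpace X] [ConnectedSpace X] [LocallyConnectedSpace X]
    (a b : X) : ∃ F : ℝ → X, Continuous F ∧ F 0 = a ∧ F 1 = b := by
  let Good : ℕ → ℕ × (ℕ → X) → Prop := fun n p => 0 < p.1 ∧ p.2 0 = a ∧
    (∀ m, p.1 ≤ m → p.2 m = b) ∧
    ∀ m, Linked ((1 / 2 : ℝ) ^ n) (p.2 m) (p.2 (m + 1))
  have hinit : ∃ p, Good 0 p := by
    obtain ⟨c, n, hc0, hcn, -, hc⟩ := (isPreconnected_univ (α := X)).exists_linked_chain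
      (one_pos (α := ℝ)) (mem_univ a) (mem_univ b)
    exact ⟨(n + 1, c), Nat.succ_pos _, hc0, fun m hm => hcn m (by simp at hm; omega),
      by simpa using hc⟩
  have hstep : ∀ n (p : {p // Good n p}), ∃ q : {q // Good (n + 1) q}, ∃ N : ℕ, 0 < N ∧
      q.1.1 = p.1.1 * N ∧ ∀ m, dist (p.1.2 (m / N)) (q.1.2 m) ≤ (1 / 2 : ℝ) ^ n := by
    rintro n ⟨⟨K, f⟩, hK0, h0, hK, hf⟩
    obtain ⟨N, g, hN, hg0, hgK, hg, hfg⟩ :=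
      exists_linked_refinement (δ := (1 / 2 : ℝ) ^ (n + 1)) (by positivity) h0 hK hf
    exact ⟨⟨(K * N, g), Nat.mul_pos hK0 hN, hg0, hgK, hg⟩, N, hN, rfl, hfg⟩
  choose next N hN hmul hdist using hstep
  obtain ⟨p₀, hp₀⟩ := hinit
  let T : ∀ n, {p // Good n p} := fun n => Nat.rec ⟨p₀, hp₀⟩ next n
  let K : ℕ → ℕ := fun n => (T n).1.1
  let f : ℕ → ℕ → X := fun n => (T n).1.2
  have hK : ∀ n, 0 < K n := fun n => (T n).2.1
  let F : ℕ → ℝ → X := fun n t => f n ⌊(K n : ℝ) * t⌋₊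
  have hF : ∀ t n, dist (F n t) (F (n + 1) t) ≤ 1 * (1 / 2 : ℝ) ^ n := by
    intro t n
    have h := hdist n (T n) ⌊(K (n + 1) : ℝ) * t⌋₊
    have hk : K (n + 1) = K n * N n (T n) := hmul n (T n)
    have hN' : (N n (T n) : ℝ) ≠ 0 := by exact_mod_cast (hN n (T n)).ne'
    have e : ⌊(K (n + 1) : ℝ) * t⌋₊ / N n (T n) = ⌊(K n : ℝ) * t⌋₊ := by
      rw [← Nat.floor_div_natCast, hk]
      congr 1
      push_cast
      field_simp
    rw [e] at h
    rw [one_mul]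
    exact h
  have hlim : ∀ t, ∃ x, Tendsto (fun n => F n t) atTop (𝓝 x) := fun t =>
    cauchySeq_tendsto_of_complete (cauchySeq_of_le_geometric (1 / 2) 1 (by norm_num) (hF t))
  choose G hG using hlim
  have hFG : ∀ t n, dist (F n t) (G t) ≤ 1 * (1 / 2 : ℝ) ^ n / (1 - 1 / 2) := fun t n =>
    dist_le_of_le_geometric_of_tendsto (1 / 2) 1 (by norm_num) (hF t) (hG t) n
  have hosc : ∀ n s t, s ≤ t → (K n : ℝ) * (t - s) < 1 →
      dist (F n s) (F n t) ≤ (1 / 2 : ℝ) ^ n := by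
    intro n s t hst h
    have h1 : ⌊(K n : ℝ) * s⌋₊ ≤ ⌊(K n : ℝ) * t⌋₊ := by gcongr
    have h2 : ⌊(K n : ℝ) * t⌋₊ ≤ ⌊(K n : ℝ) * s⌋₊ + 1 := by
      by_cases h3 : 0 ≤ (K n : ℝ) * s
      · rw [← Nat.floor_add_one h3]
        gcongr
        linarith
      · have h4 : ⌊(K n : ℝ) * t⌋₊ < 1 := (Nat.floor_lt' one_ne_zero).2 (by push_cast; linarith)
        omega
    rcases h1.eq_or_lt with h3 | h3
    · simp [F, h3]
    · have h4 : ⌊(K n : ℝ) * t⌋₊ = ⌊(K n : ℝ) * s⌋₊ + 1 := by omega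
      simp only [F, h4]
      exact ((T n).2.2.2.2 _).dist_le
  refine ⟨G, ?_, ?_, ?_⟩
  · rw [Metric.continuous_iff]
    intro t ε hε
    obtain ⟨n, hn⟩ := exists_pow_lt_of_lt_one (show 0 < ε / 5 by positivity)
      (show (1 / 2 : ℝ) < 1 by norm_num)
    have hKn : (0 : ℝ) < K n := by exact_mod_cast hK n
    refine ⟨1 / K n, by positivity, fun s hs => ?_⟩
    have hs' : (K n : ℝ) * |s - t| < 1 := by
      rw [Real.dist_eq, lt_div_iff₀ hKn] at hs
      linarith
    have h1 : dist (F n s) (F n t) ≤ (1 / 2 : ℝ) ^ n := by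
      rcases le_total s t with h | h
      · exact hosc n s t h (by rwa [abs_sub_comm, abs_of_nonneg (sub_nonneg.2 h)] at hs')
      · rw [dist_comm]
        exact hosc n t s h (by rwa [abs_of_nonneg (sub_nonneg.2 h)] at hs')
    have h2 := hFG s n
    have h3 := hFG t n
    have h4 := dist_triangle4 (G s) (F n s) (F n t) (G t)
    rw [dist_comm] at h2
    norm_num at h2 h3 h1 hn
    linarith
  · refine tendsto_nhds_unique (hG 0) (tendsto_const_nhds.congr fun n => ?_)
    simpa [F] using (T n).2.2.1.symm
  · refine tendsto_nhds_unique (hG 1) (tendsto_const_nhds.congr fun n => ?_)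
    simpa [F] using ((T n).2.2.2.1 _ le_rfl).symm

end PathConnected
section Arc

/-- A continuous function vanishing at `q` has a continuous running supremum from `q`
on. -/
theorem exists_continuous_runningSup {v : ℝ → ℝ} (hv : Continuous v) {q : ℝ} (hq : v q = 0) :
    ∃ M : ℝ → ℝ, Continuous M ∧ (∀ x, 0 ≤ M x) ∧ (∀ x w, q ≤ w → w ≤ x → v w ≤ M x) ∧
      ∀ x c, 0 ≤ c → (∀ w, q ≤ w → w ≤ x → v w ≤ c) → M x ≤ c := by
  let h : ℝ → ℝ → ℝ := fun x u => v (q + u * max (x - q) 0)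
  have hh : Continuous ↿h := by
    change Continuous fun p : ℝ × ℝ => v (q + p.2 * max (p.1 - q) 0)
    fun_prop
  have hhx : ∀ x, Continuous (h x) := fun x => by
    change Continuous fun u => v (q + u * max (x - q) 0)
    fun_prop
  refine ⟨fun x => sSup (h x '' Icc 0 1), isCompact_Icc.continuous_sSup hh, ?_, ?_, ?_⟩
  · intro x
    refine le_csSup (isCompact_Icc.image (hhx x)).bddAbove ⟨0, by simp, by simp [h, hq]⟩
  · intro x w hqw hwx
    refine le_csSup (isCompact_Icc.image (hhx x)).bddAbove ?_
    rcases hqw.eq_or_lt with rfl | hlt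
    · exact ⟨0, by simp, by simp [h]⟩
    · have h1 : 0 < x - q := by linarith
      refine ⟨(w - q) / (x - q), ⟨div_nonneg (by linarith) h1.le, ?_⟩, ?_⟩
      · rw [div_le_one h1]; linarith
      · simp only [h, max_eq_left h1.le]
        rw [div_mul_cancel₀ _ h1.ne']
        congr 1; ring
  · intro x c hc hw
    refine csSup_le ((nonempty_Icc.2 zero_le_one).image _) ?_
    rintro _ ⟨u, ⟨hu0, hu1⟩, rfl⟩
    rcases le_total (x - q) 0 with h1 | h1
    · simpa [h, max_eq_right h1, hq] using hc
    · simp only [h, max_eq_left h1]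
      exact hw _ (by nlinarith) (by nlinarith)

variable {X : Type*} [MetricSpace X]

/-- A path whose fibres are intervals factors through a monotone function which separates the
fibres. -/
theorem exists_continuous_separating_fibres {F : ℝ → X} (hF : Continuous F)
    (hmono : ∀ x y z, 0 ≤ x → x ≤ y → y ≤ z → z ≤ 1 → F x = F z → F y = F x) :
    ∃ g : ℝ → ℝ, Continuous g ∧ Monotone g ∧
      ∀ x y, 0 ≤ x → x ≤ y → y ≤ 1 → (g x = g y ↔ F x = F y) := by
  let v : ℝ → ℝ → ℝ := fun q w => min 1 (dist (F w) (F q))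
  have hvq : ∀ q, v q q = 0 := fun q => by simp [v]
  have hM := fun q => exists_continuous_runningSup (v := v q) (by fun_prop) (hvq q)
  choose M hMc hM0 hM1 hM2 using hM
  have hMmono : ∀ q, Monotone (M q) := fun q x y hxy =>
    hM2 q x _ (hM0 q y) fun w hqw hwx => hM1 q y w hqw (hwx.trans hxy)
  have hMle : ∀ q x, M q x ≤ 1 := fun q x => hM2 q x 1 zero_le_one fun w _ _ => min_le_left _ _
  have hMfib : ∀ q x y, 0 ≤ x → x ≤ y → y ≤ 1 → F x = F y → M q x = M q y := by
    intro q x y hx hxy hy hF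
    refine (hMmono q hxy).antisymm (hM2 q y _ (hM0 q x) fun w hqw hwy => ?_)
    rcases le_total w x with hwx | hwx
    · exact hM1 q x w hqw hwx
    · have hFw := hmono x w y hx hwx hwy hy hF
      rcases le_total q x with hqx | hqx
      · have := hM1 q x x hqx le_rfl
        simpa only [v, hFw] using this
      · have hFq := hmono x q y hx hqx (hqw.trans hwy) hy hF
        simpa [v, hFw, hFq] using hM0 q x
  have hs : ∀ x, Summable fun n : ℕ => (1 / 2 : ℝ) ^ n * M (denseSeq ℝ n) x := fun x =>
    summable_geometric_two.of_nonneg_of_le (fun n => mul_nonneg (by positivity) (hM0 _ _))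
      fun n => mul_le_of_le_one_right (by positivity) (hMle _ _)
  refine ⟨fun x => ∑' n : ℕ, (1 / 2 : ℝ) ^ n * M (denseSeq ℝ n) x, ?_, ?_, ?_⟩
  · refine continuous_tsum (fun n => (hMc _).const_mul _) summable_geometric_two fun n x => ?_
    rw [Real.norm_of_nonneg (mul_nonneg (by positivity) (hM0 _ _))]
    exact mul_le_of_le_one_right (by positivity) (hMle _ _)
  · exact fun x y hxy => (hs x).tsum_le_tsum
      (fun n => mul_le_mul_of_nonneg_left (hMmono _ hxy) (by positivity)) (hs y)
  · intro x y hx hxy hy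
    refine ⟨fun h => ?_, fun h => tsum_congr fun n => by rw [hMfib _ x y hx hxy hy h]⟩
    by_contra hne
    have hlt : x < y := hxy.lt_of_ne fun e => hne (e ▸ rfl)
    have hU : IsOpen (Ioo x y ∩ {z | F z ≠ F y}) :=
      isOpen_Ioo.inter (isOpen_ne_fun hF continuous_const)
    have hUne : (Ioo x y ∩ {z | F z ≠ F y}).Nonempty := by
      have h1 : {z | F z ≠ F y} ∈ 𝓝[>] x :=
        mem_nhdsWithin_of_mem_nhds ((isOpen_ne_fun hF continuous_const).mem_nhds hne)
      exact nonempty_of_mem (inter_mem (Ioo_mem_nhdsGT hlt) h1)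
    obtain ⟨n, ⟨hxq, hqy⟩, hFq⟩ := (denseRange_denseSeq ℝ).exists_mem_open hU hUne
    refine ((hs x).tsum_lt_tsum (i := n)
      (fun n => mul_le_mul_of_nonneg_left (hMmono _ hxy) (by positivity)) ?_ (hs y)).ne h
    refine mul_lt_mul_of_pos_left ?_ (by positivity)
    calc M (denseSeq ℝ n) x ≤ 0 := hM2 _ x 0 le_rfl fun w hqw hwx => by linarith
      _ < v (denseSeq ℝ n) y := lt_min one_pos (dist_pos.2 (Ne.symm hFq))
      _ ≤ _ := hM1 _ y y hqy.le le_rfl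

/-- A path whose fibres are intervals can be reparametrized to an arc. -/
theorem exists_arc_of_interval_fibres {F : ℝ → X} (hF : Continuous F)
    (hmono : ∀ x y z, 0 ≤ x → x ≤ y → y ≤ z → z ≤ 1 → F x = F z → F y = F x)
    (hne : F 0 ≠ F 1) : ∃ (A B : ℝ) (β : ℝ → X), A < B ∧ ContinuousOn β (Icc A B) ∧
      InjOn β (Icc A B) ∧ β A = F 0 ∧ β B = F 1 := by
  obtain ⟨g, hg, hgm, hgF⟩ := exists_continuous_separating_fibres hF hmono
  have hgF' : ∀ x ∈ Icc (0 : ℝ) 1, ∀ y ∈ Icc (0 : ℝ) 1, (g x = g y ↔ F x = F y) := by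
    intro x hx y hy
    rcases le_total x y with h | h
    · exact hgF x y hx.1 h hy.2
    · rw [eq_comm, hgF y x hy.1 h hx.2, eq_comm]
  have hsurj : ∀ y, ∃ x, y ∈ Icc (g 0) (g 1) → x ∈ Icc (0 : ℝ) 1 ∧ g x = y := by
    intro y
    by_cases hy : y ∈ Icc (g 0) (g 1)
    · obtain ⟨x, hx⟩ := intermediate_value_Icc zero_le_one hg.continuousOn hy
      exact ⟨x, fun _ => hx⟩
    · exact ⟨0, fun h => absurd h hy⟩
  choose k hk using hsurj
  have hβ : ∀ x ∈ Icc (0 : ℝ) 1, F (k (g x)) = F x := by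
    intro x hx
    obtain ⟨h1, h2⟩ := hk (g x) ⟨hgm hx.1, hgm hx.2⟩
    exact (hgF' _ h1 _ hx).1 h2
  have h0 : (0 : ℝ) ∈ Icc (0 : ℝ) 1 := by simp
  have h1 : (1 : ℝ) ∈ Icc (0 : ℝ) 1 := by simp
  refine ⟨g 0, g 1, fun y => F (k y), ?_, ?_, ?_, hβ 0 h0, hβ 1 h1⟩
  · exact (hgm zero_le_one).lt_of_ne fun h => hne ((hgF' _ h0 _ h1).1 h)
  · rw [continuousOn_iff_isClosed]
    intro E hE
    refine ⟨g '' (Icc 0 1 ∩ F ⁻¹' E),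
      ((isCompact_Icc.inter_right (hE.preimage hF)).image hg).isClosed, ?_⟩
    ext y
    constructor
    · rintro ⟨hyE, hy⟩
      exact ⟨⟨k y, ⟨(hk y hy).1, hyE⟩, (hk y hy).2⟩, hy⟩
    · rintro ⟨⟨x, ⟨hx, hxE⟩, rfl⟩, hy⟩
      refine ⟨?_, hy⟩
      rw [mem_preimage, hβ x hx]
      exact hxE
  · intro y hy z hz hyz
    obtain ⟨hy1, hy2⟩ := hk y hy
    obtain ⟨hz1, hz2⟩ := hk z hz
    rw [← hy2, ← hz2]
    exact (hgF' _ hy1 _ hz1).2 hyz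

/-- Any path from `f 0` to `f 1` contains a path with interval fibres. -/
theorem exists_interval_fibres_of_path {f : ℝ → X} (hf : Continuous f) :
    ∃ F : ℝ → X, Continuous F ∧
      (∀ x y z, 0 ≤ x → x ≤ y → y ≤ z → z ≤ 1 → F x = F z → F y = F x) ∧
      F 0 = f 0 ∧ F 1 = f 1 := by
  let 𝒞 : Set (Set ℝ) := {C | IsClosed C ∧ C ⊆ Icc 0 1 ∧ 0 ∈ C ∧ 1 ∈ C ∧
    ∀ a ∈ C, ∀ b ∈ C, a < b → (∀ x ∈ C, ¬ (a < x ∧ x < b)) → f a = f b}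
  have hIcc : Icc (0 : ℝ) 1 ∈ 𝒞 := by
    refine ⟨isClosed_Icc, Subset.rfl, by simp, by simp, fun a ha b hb hab h => ?_⟩
    exact absurd ⟨by linarith, by linarith⟩
      (h ((a + b) / 2) ⟨by linarith [ha.1, hb.1], by linarith [ha.2, hb.2]⟩)
  have hchain : ∀ c ⊆ 𝒞, IsChain (· ⊆ ·) c → c.Nonempty → ∃ lb ∈ 𝒞, ∀ s ∈ c, lb ⊆ s := by
    intro c hc hch hne
    refine ⟨⋂₀ c, ⟨isClosed_sInter fun s hs => (hc hs).1, ?_, fun s hs => (hc hs).2.2.1,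
      fun s hs => (hc hs).2.2.2.1, ?_⟩, fun s hs => sInter_subset_of_mem hs⟩
    · obtain ⟨s, hs⟩ := hne
      exact (sInter_subset_of_mem hs).trans (hc hs).2.1
    · intro a ha b hb hab hgap
      refine eq_of_forall_dist_le fun ε hε => ?_
      obtain ⟨δa, hδa, hfa⟩ := Metric.continuous_iff.1 hf a (ε / 2) (half_pos hε)
      obtain ⟨δb, hδb, hfb⟩ := Metric.continuous_iff.1 hf b (ε / 2) (half_pos hε)
      obtain ⟨m, ham, hmδ⟩ := exists_between (show a < min (a + δa) ((a + b) / 2) from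
        lt_min (by linarith) (by linarith))
      obtain ⟨n, hnδ, hnb⟩ := exists_between (show max (b - δb) ((a + b) / 2) < b from
        max_lt (by linarith) (by linarith))
      obtain ⟨hm1, hm2⟩ := lt_min_iff.1 hmδ
      obtain ⟨hn1, hn2⟩ := max_lt_iff.1 hnδ
      have hex : ∃ s ∈ c, ∀ x ∈ s, ¬ (m ≤ x ∧ x ≤ n) := by
        by_contra! hcon
        have hdir : DirectedOn (· ⊇ ·) ((fun s => s ∩ Icc m n) '' c) := by
          rintro _ ⟨s, hs, rfl⟩ _ ⟨t, ht, rfl⟩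
          rcases hch.total hs ht with h | h
          · exact ⟨_, ⟨s, hs, rfl⟩, Subset.rfl, inter_subset_inter_left _ h⟩
          · exact ⟨_, ⟨t, ht, rfl⟩, inter_subset_inter_left _ h, Subset.rfl⟩
        have := (hne.image fun s => s ∩ Icc m n).to_subtype
        obtain ⟨x, hx⟩ := IsCompact.nonempty_sInter_of_directed_nonempty_isCompact_isClosed
          hdir
          (by
            rintro _ ⟨s, hs, rfl⟩
            obtain ⟨x, hx, h⟩ := hcon s hs
            exact ⟨x, hx, h⟩)
          (by
            rintro _ ⟨s, hs, rfl⟩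
            exact isCompact_Icc.inter_left (hc hs).1)
          (by
            rintro _ ⟨s, hs, rfl⟩
            exact (hc hs).1.inter isClosed_Icc)
        have hx' : ∀ s ∈ c, x ∈ s ∧ x ∈ Icc m n := fun s hs => hx _ ⟨s, hs, rfl⟩
        obtain ⟨s, hs⟩ := hne
        have := (hx' s hs).2
        exact hgap x (fun s hs => (hx' s hs).1) ⟨by linarith [this.1], by linarith [this.2]⟩
      obtain ⟨s, hs, hsgap⟩ := hex
      obtain ⟨hsc, -, -, -, hsf⟩ := hc hs
      obtain ⟨a', ⟨ha's, ha'⟩, ha'max⟩ := (isCompact_Icc.inter_left hsc).exists_isGreatest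
        ⟨a, ha s hs, left_mem_Icc.2 ham.le⟩
      obtain ⟨b', ⟨hb's, hb'⟩, hb'min⟩ := (isCompact_Icc.inter_left hsc).exists_isLeast
        ⟨b, hb s hs, right_mem_Icc.2 hnb.le⟩
      have heq : f a' = f b' := by
        refine hsf a' ha's b' hb's (by linarith [ha'.2, hb'.1]) fun x hx hxab => ?_
        by_cases h1 : x ≤ m
        · exact absurd (ha'max ⟨hx, ha'.1.trans hxab.1.le, h1⟩) (not_le.2 hxab.1)
        · by_cases h2 : n ≤ x
          · exact absurd (hb'min ⟨hx, h2, hxab.2.le.trans hb'.2⟩) (not_le.2 hxab.2)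
          · exact hsgap x hx ⟨by linarith, by linarith⟩
      have h1 := hfa a' (by rw [Real.dist_eq, abs_lt]; constructor <;> linarith [ha'.1, ha'.2])
      have h2 := hfb b' (by rw [Real.dist_eq, abs_lt]; constructor <;> linarith [hb'.1, hb'.2])
      rw [heq] at h1
      rw [dist_comm] at h1
      linarith [dist_triangle (f a) (f b') (f b)]
  obtain ⟨C, -, hCmin⟩ := zorn_superset_nonempty 𝒞 hchain _ hIcc
  obtain ⟨hCc, hC01, hC0, hC1, hCf⟩ := hCmin.prop
  have hCgap : ∀ s ∈ C, ∀ t ∈ C, f s = f t → ∀ x ∈ C, ¬ (s < x ∧ x < t) := by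
    intro s hs t ht hst x hx hxst
    have hmem : C \ Ioo s t ∈ 𝒞 := by
      refine ⟨hCc.sdiff isOpen_Ioo, sdiff_subset.trans hC01, ⟨hC0, fun h => ?_⟩,
        ⟨hC1, fun h => ?_⟩, ?_⟩
      · exact absurd (hC01 hs).1 (not_le.2 h.1)
      · exact absurd (hC01 ht).2 (not_le.2 h.2)
      · intro a ha b hb hab hgap
        by_cases h : ∀ x ∈ C, ¬ (a < x ∧ x < b)
        · exact hCf a ha.1 b hb.1 hab h
        · push Not at h
          obtain ⟨z, hz, haz, hzb⟩ := h
          have hz' : s < z ∧ z < t := by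
            by_contra hcon
            exact hgap z ⟨hz, hcon⟩ ⟨haz, hzb⟩
          have e1 : a = s := by
            refine le_antisymm ?_ ?_
            · by_contra! h
              exact ha.2 ⟨h, haz.trans hz'.2⟩
            · by_contra! h
              exact hgap s ⟨hs, fun h => lt_irrefl _ h.1⟩ ⟨h, hz'.1.trans hzb⟩
          have e2 : b = t := by
            refine le_antisymm ?_ ?_
            · by_contra! h
              exact hgap t ⟨ht, fun h => lt_irrefl _ h.2⟩ ⟨haz.trans hz'.2, h⟩
            · by_contra! h
              exact hb.2 ⟨hz'.1.trans hzb, h⟩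
          rw [e1, e2, hst]
    exact (hCmin.le_of_le hmem sdiff_subset hx).2 hxst
  have hL : ∀ x, ∃ l, 0 ≤ x → IsGreatest (C ∩ Icc 0 x) l := by
    intro x
    by_cases hx : 0 ≤ x
    · obtain ⟨l, hl⟩ := (isCompact_Icc.inter_left hCc).exists_isGreatest
        ⟨0, hC0, left_mem_Icc.2 hx⟩
      exact ⟨l, fun _ => hl⟩
    · exact ⟨0, fun h => absurd h hx⟩
  have hR : ∀ x, ∃ r, x ≤ 1 → IsLeast (C ∩ Icc x 1) r := by
    intro x
    by_cases hx : x ≤ 1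
    · obtain ⟨l, hl⟩ := (isCompact_Icc.inter_left hCc).exists_isLeast
        ⟨1, hC1, right_mem_Icc.2 hx⟩
      exact ⟨l, fun _ => hl⟩
    · exact ⟨0, fun h => absurd h hx⟩
  choose L hL using hL
  choose R hR using hR
  have hLR : ∀ x ∈ Icc (0 : ℝ) 1, f (L x) = f (R x) := by
    intro x hx
    obtain ⟨⟨hLC, hLx⟩, hLmax⟩ := hL x hx.1
    obtain ⟨⟨hRC, hRx⟩, hRmin⟩ := hR x hx.2
    rcases (hLx.2.trans hRx.1).eq_or_lt with h | h
    · rw [h]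
    · refine hCf _ hLC _ hRC h fun z hz hzLR => ?_
      rcases le_total z x with h | h
      · exact absurd (hLmax ⟨hz, (hC01 hz).1, h⟩) (not_le.2 hzLR.1)
      · exact absurd (hRmin ⟨hz, h, (hC01 hz).2⟩) (not_le.2 hzLR.2)
  have hfL_of_gap : ∀ x y, 0 ≤ x → x ≤ y → (∀ z ∈ C, ¬ (x < z ∧ z ≤ y)) → L x = L y := by
    intro x y hx hxy hgap
    obtain ⟨⟨hLC, hLx⟩, hLmax⟩ := hL x hx
    obtain ⟨⟨hLC', hLy⟩, hLmax'⟩ := hL y (hx.trans hxy)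
    refine le_antisymm (hLmax' ⟨hLC, hLx.1, hLx.2.trans hxy⟩) (hLmax ⟨hLC', hLy.1, ?_⟩)
    by_contra! h
    exact hgap _ hLC' ⟨h, hLy.2⟩
  have hL_of_mem : ∀ x ∈ C, L x = x := fun x hx =>
    (hL x (hC01 hx).1).unique ⟨⟨hx, (hC01 hx).1, le_rfl⟩, fun z hz => hz.2.2⟩
  have hcont : ContinuousOn (fun x => f (L x)) (Icc 0 1) := by
    rw [Metric.continuousOn_iff]
    intro x hx ε hε
    obtain ⟨δ, hδ, hδf⟩ := Metric.uniformContinuousOn_iff.1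
      (isCompact_Icc.uniformContinuousOn_of_continuous (hf.continuousOn (s := Icc 0 1))) ε hε
    have key : ∀ x ∈ Icc (0 : ℝ) 1, ∀ y ∈ Icc (0 : ℝ) 1, x ≤ y → dist x y < δ →
        dist (f (L x)) (f (L y)) < ε := by
      intro x hx y hy hxy hd
      by_cases hgap : ∀ z ∈ C, ¬ (x < z ∧ z ≤ y)
      · rw [hfL_of_gap x y hx.1 hxy hgap, dist_self]
        exact hε
      · push Not at hgap
        obtain ⟨z, hz, hxz, hzy⟩ := hgap
        rw [hLR x hx]
        obtain ⟨⟨hLC, hLy⟩, hLmax⟩ := hL y hy.1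
        obtain ⟨⟨hRC, hRx⟩, hRmin⟩ := hR x hx.2
        have h1 := hLmax ⟨hz, (hC01 hz).1, hzy⟩
        have h2 := hRmin ⟨hz, hxz.le, (hC01 hz).2⟩
        refine hδf _ (hC01 hRC) _ (hC01 hLC) (lt_of_le_of_lt ?_ hd)
        rw [Real.dist_eq, Real.dist_eq, abs_of_nonpos (by linarith), abs_of_nonpos (by linarith)]
        linarith [hLy.2, hRx.1]
    refine ⟨δ, hδ, fun y hy hyx => ?_⟩
    rcases le_total x y with h | h
    · rw [dist_comm]
      exact key x hx y hy h (by rwa [dist_comm])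
    · exact key y hy x hx h hyx
  have hproj : ∀ x ∈ Icc (0 : ℝ) 1, max 0 (min x 1) = x := fun x hx => by
    rw [min_eq_left hx.2, max_eq_right hx.1]
  refine ⟨fun x => f (L (max 0 (min x 1))), ?_, ?_, ?_, ?_⟩
  · exact hcont.comp_continuous (f := fun x : ℝ => max 0 (min x 1)) (by fun_prop)
      fun x => ⟨le_max_left _ _, max_le zero_le_one (min_le_right _ _)⟩
  · intro x y z hx hxy hyz hz
    dsimp only
    rw [hproj x ⟨hx, by linarith⟩, hproj y ⟨by linarith, by linarith⟩, hproj z ⟨by linarith, hz⟩]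
    intro h
    obtain ⟨⟨hLC, hLx⟩, hLmax⟩ := hL x hx
    obtain ⟨⟨hLC', hLy⟩, hLmax'⟩ := hL y (hx.trans hxy)
    obtain ⟨⟨hLC'', hLz⟩, hLmax''⟩ := hL z (by linarith)
    have h1 : L x ≤ L y := hLmax' ⟨hLC, hLx.1, hLx.2.trans hxy⟩
    have h2 : L y ≤ L z := hLmax'' ⟨hLC', hLy.1, hLy.2.trans hyz⟩
    rcases h1.eq_or_lt with h1 | h1
    · rw [h1]
    · rcases h2.eq_or_lt with h2 | h2
      · rw [h2, h]
      · exact absurd ⟨h1, h2⟩ (hCgap _ hLC _ hLC'' h _ hLC')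
  · simp [hL_of_mem 0 hC0]
  · simp [hL_of_mem 1 hC1]

/-- In a completely metrizable connected locally connected space any two distinct points
are joined by an arc. -/
theorem exists_arc {X : Type*} [TopologicalSpace X] [IsCompletelyMetrizableSpace X]
    [ConnectedSpace X] [LocallyConnectedSpace X] {a b : X} (hab : a ≠ b) :
    ∃ (A B : ℝ) (β : ℝ → X), A < B ∧ ContinuousOn β (Icc A B) ∧
      InjOn β (Icc A B) ∧ β A = a ∧ β B = b := by
  let := upgradeIsCompletelyMetrizable X
  obtain ⟨f, hf, rfl, rfl⟩ := exists_continuous_path a b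
  obtain ⟨F, hF, hmono, h0, h1⟩ := exists_interval_fibres_of_path hf
  rw [← h0, ← h1] at hab ⊢
  exact exists_arc_of_interval_fibres hF hmono hab

end Arc
section Components

variable {D : Type*} [TopologicalSpace D]

/-- A connected set that meets a component of an open set `F` without being contained in it
contains a point outside `F` in the closure of the component. -/
theorem exists_mem_closure_connectedComponentIn [LocallyConnectedSpace D]
    {F V : Set D} (hV : IsPreconnected V) (hF : IsOpen F) {x y z : D}
    (hyV : y ∈ V) (hy : y ∈ connectedComponentIn F x) (hzV : z ∈ V)
    (hz : z ∉ connectedComponentIn F x) :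
    ∃ w ∈ V, w ∈ closure (connectedComponentIn F x) ∧ w ∉ F := by
  by_contra! hcon
  refine hz (hV.subset_of_closure_inter_subset hF.connectedComponentIn ⟨y, hyV, hy⟩ ?_ hzV)
  rintro w ⟨hwc, hwV⟩
  have hwF := hcon w hwV hwc
  obtain ⟨u, hu, hux⟩ := mem_closure_iff.1 hwc _ (hF.connectedComponentIn (x := w))
    (mem_connectedComponentIn hwF)
  rw [connectedComponentIn_eq hux, ← connectedComponentIn_eq hu]
  exact mem_connectedComponentIn hwF

/-- Every point `x₀ ≠ p` is or separates from `p` an end point. -/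
theorem exists_mem_endPoints_notMem_connectedComponentIn [T2Space D] [CompactSpace D]
    [ConnectedSpace D] [LocallyConnectedSpace D] {p x₀ : D} (hx₀ : x₀ ≠ p) :
    ∃ e ∈ endPoints D, e ∉ connectedComponentIn {x₀}ᶜ p := by
  let B : D → Set D := fun x => (connectedComponentIn {x}ᶜ p)ᶜ
  have hself : ∀ x, x ∈ B x := fun x h => connectedComponentIn_subset _ _ h rfl
  have hopen : ∀ x, IsOpen (connectedComponentIn {x}ᶜ p) := fun x =>
    isOpen_compl_singleton.connectedComponentIn
  have hnot : ∀ x, x ≠ p → p ∉ B x := fun x hx h => h (mem_connectedComponentIn hx.symm)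
  have key : ∀ x y, x ≠ p → y ∈ B x → y ≠ x → B y ⊆ B x ∧ x ∉ B y := by
    intro x y hx hy hyx
    obtain ⟨w, -, hw, hwx⟩ := exists_mem_closure_connectedComponentIn isPreconnected_univ
      (isOpen_compl_singleton (x := x)) (mem_univ p) (mem_connectedComponentIn hx.symm)
      (mem_univ x) (hself x)
    obtain rfl : w = x := by simpa using hwx
    have hT : IsPreconnected (insert w (connectedComponentIn {w}ᶜ p)) :=
      isPreconnected_connectedComponentIn.subset_closure (subset_insert _ _)
        (insert_subset hw subset_closure)
    have hsub : insert w (connectedComponentIn {w}ᶜ p) ⊆ connectedComponentIn {y}ᶜ p := by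
      refine hT.subset_connectedComponentIn (mem_insert_of_mem _ (mem_connectedComponentIn hx.symm))
        (insert_subset (by simpa using hyx.symm) fun z hz hzy => ?_)
      rw [mem_singleton_iff] at hzy
      exact hy (hzy ▸ hz)
    exact ⟨compl_subset_compl.2 ((subset_insert _ _).trans hsub),
      fun h => h (hsub (mem_insert _ _))⟩
  have hchain : ∀ c ⊆ B '' {p}ᶜ, IsChain (· ⊆ ·) c → c.Nonempty →
      ∃ lb ∈ B '' {p}ᶜ, ∀ s ∈ c, lb ⊆ s := by
    intro c hc hch hne
    have := hne.to_subtype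
    obtain ⟨y, hy⟩ := IsCompact.nonempty_sInter_of_directed_nonempty_isCompact_isClosed (S := c)
      (IsChain.directedOn hch.symm)
      (fun s hs => by
        obtain ⟨x, -, rfl⟩ := hc hs
        exact ⟨x, hself x⟩)
      (fun s hs => by
        obtain ⟨x, -, rfl⟩ := hc hs
        exact (hopen x).isClosed_compl.isCompact)
      (fun s hs => by
        obtain ⟨x, -, rfl⟩ := hc hs
        exact (hopen x).isClosed_compl)
    refine ⟨B y, ⟨y, fun hyp => ?_, rfl⟩, fun s hs => ?_⟩
    · obtain ⟨s, hs⟩ := hne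
      have hys := hy s hs
      obtain ⟨x, hx, rfl⟩ := hc hs
      rw [mem_singleton_iff] at hyp
      exact hnot x hx (hyp ▸ hys)
    · have hys := hy s hs
      obtain ⟨x, hx, rfl⟩ := hc hs
      by_cases hyx : y = x
      · rw [hyx]
      · exact (key x y hx hys hyx).1
  obtain ⟨_, hsub, hmin⟩ := zorn_superset_nonempty _ hchain (B x₀) ⟨x₀, hx₀, rfl⟩
  obtain ⟨e, he, rfl⟩ := hmin.prop
  refine ⟨e, ?_, hsub (hself e)⟩
  have heq : ({e}ᶜ : Set D) = connectedComponentIn {e}ᶜ p := by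
    refine Subset.antisymm (fun y hy => ?_) (connectedComponentIn_subset _ _)
    by_contra hyB
    have hk := key e y he hyB hy
    refine hk.2 (hmin.le_of_le ⟨y, fun hyp => ?_, rfl⟩ hk.1 (hself e))
    rw [mem_singleton_iff] at hyp
    exact hnot e he (hyp ▸ hyB)
  change IsConnected ({e}ᶜ : Set D)
  rw [heq]
  exact isConnected_connectedComponentIn_iff.2 (Ne.symm he)

/-- A component of the complement of an arc is attached to each subarc which is not free. -/
theorem exists_mem_closure_connectedComponentIn_of_not_isOpen [T2Space D]
    [LocallyConnectedSpace D] (γ : C(unitInterval, D)) (hγ : Function.Injective γ)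
    {s t : unitInterval} (hst : ¬ IsOpen (γ '' Ioo s t)) :
    ∃ r ∈ Ioo s t, ∃ x ∉ range γ, γ r ∈ closure (connectedComponentIn (range γ)ᶜ x) := by
  have hA : IsOpen (range γ)ᶜ := (isCompact_range γ.continuous).isClosed.isOpen_compl
  rw [isOpen_iff_mem_nhds] at hst
  push Not at hst
  obtain ⟨_, ⟨r, hr, rfl⟩, hnhds⟩ := hst
  have hW : (γ '' (Ioo s t)ᶜ)ᶜ ∈ 𝓝 (γ r) := by
    refine (isOpen_Ioo.isClosed_compl.isCompact.image γ.continuous).isClosed.isOpen_compl.mem_nhds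
      ?_
    rintro ⟨r', hr', h⟩
    exact hr' (hγ h ▸ hr)
  obtain ⟨V, ⟨hVo, hrV, hVc⟩, hV⟩ :=
    (LocallyConnectedSpace.open_connected_basis (γ r)).mem_iff.1 hW
  obtain ⟨x, hxV, hx⟩ : ∃ x ∈ V, x ∉ γ '' Ioo s t := by
    by_contra! h
    exact hnhds (mem_of_superset (hVo.mem_nhds hrV) h)
  have hxA : x ∉ range γ := by
    rintro ⟨y, rfl⟩
    by_cases hy : y ∈ Ioo s t
    · exact hx ⟨y, hy, rfl⟩
    · exact hV hxV ⟨y, hy, rfl⟩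
  obtain ⟨w, hwV, hw, hwA⟩ := exists_mem_closure_connectedComponentIn hVc.isPreconnected hA hxV
    (mem_connectedComponentIn hxA) hrV
    (fun h => connectedComponentIn_subset _ _ h (mem_range_self r))
  obtain ⟨r', rfl⟩ := not_not.1 hwA
  exact ⟨r', by_contra fun h => hV hwV ⟨r', h, rfl⟩, x, hxA, hw⟩

end Components

section Circle

/-- Two arcs with common ends and otherwise disjoint form a circle. -/
theorem exists_homeomorph_circle_of_arcs {X : Type*} [TopologicalSpace X] [T2Space X]
    {α β : ℝ → X} {a b u v : ℝ} (hab : a < b) (huv : u < v)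
    (hα : ContinuousOn α (Icc a b)) (hβ : ContinuousOn β (Icc u v))
    (hαi : InjOn α (Icc a b)) (hβi : InjOn β (Icc u v)) (hu : α a = β u) (hv : α b = β v)
    (hdisj : ∀ x ∈ Ioo u v, β x ∉ α '' Icc a b) : ∃ S : Set X, Nonempty (S ≃ₜ Circle) := by
  let p : ℝ := b - a + (v - u)
  have hp : 0 < p := by simp only [p]; linarith
  have : Fact (0 < p) := ⟨hp⟩
  let h : ℝ → X := fun x => if x ≤ b then α x else β (v - (x - b))
  have h1 : ∀ x, x ≤ b → h x = α x := fun x hx => if_pos hx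
  have h2 : ∀ x, b ≤ x → h x = β (v - (x - b)) := by
    intro x hx
    rcases hx.eq_or_lt with rfl | hx
    · simp [h, hv]
    · exact if_neg (not_le.2 hx)
  have hap : a + p = b + (v - u) := by simp only [p]; ring
  have hc : ContinuousOn h (Icc a (a + p)) := by
    rw [hap, ← Icc_union_Icc_eq_Icc hab.le (by linarith : b ≤ b + (v - u))]
    refine ContinuousOn.union_of_isClosed (hα.congr fun x hx => h1 x hx.2) ?_ isClosed_Icc
      isClosed_Icc
    refine ContinuousOn.congr (hβ.comp (f := fun x => v - (x - b)) (by fun_prop) ?_)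
      fun x hx => h2 x hx.1
    intro x hx
    exact ⟨by linarith [hx.2], by linarith [hx.1]⟩
  have hend : h a = h (a + p) := by
    rw [h1 a hab.le, h2 (a + p) (by linarith), hu, hap]
    congr 1; ring
  have hcross : ∀ x y, x ∈ Ico a (a + p) → y ∈ Ico a (a + p) → x ≤ b → b < y → h x ≠ h y := by
    intro x y hx hy hxb hyb
    rw [hap] at hy
    rw [h1 x hxb, h2 y hyb.le]
    intro heq
    exact hdisj (v - (y - b)) ⟨by linarith [hy.2], by linarith⟩ ⟨x, ⟨hx.1, hxb⟩, heq⟩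
  have hinj : InjOn h (Ico a (a + p)) := by
    intro x hx y hy heq
    rcases le_or_gt x b with hxb | hxb <;> rcases le_or_gt y b with hyb | hyb
    · rw [h1 x hxb, h1 y hyb] at heq
      exact hαi ⟨hx.1, hxb⟩ ⟨hy.1, hyb⟩ heq
    · exact absurd heq (hcross x y hx hy hxb hyb)
    · exact absurd heq.symm (hcross y x hy hx hyb hxb)
    · rw [h2 x hxb.le, h2 y hyb.le] at heq
      rw [hap] at hx hy
      have := hβi ⟨by linarith [hx.2], by linarith⟩ ⟨by linarith [hy.2], by linarith⟩ heq
      linarith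
  have hlift : Function.Injective (AddCircle.liftIco p a h) := by
    intro x y hxy
    have hx : x ∈ ((↑) : ℝ → AddCircle p) '' Ico a (a + p) := by
      rw [AddCircle.coe_image_Ico_eq]; trivial
    have hy : y ∈ ((↑) : ℝ → AddCircle p) '' Ico a (a + p) := by
      rw [AddCircle.coe_image_Ico_eq]; trivial
    obtain ⟨x, hx, rfl⟩ := hx
    obtain ⟨y, hy, rfl⟩ := hy
    rw [AddCircle.liftIco_coe_apply hx, AddCircle.liftIco_coe_apply hy] at hxy
    rw [hinj hx hy hxy]
  have hemb := ((AddCircle.liftIco_continuous hend hc).isClosedEmbedding hlift).isEmbedding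
  exact ⟨_, ⟨hemb.toHomeomorph.symm.trans (AddCircle.homeomorphCircle hp.ne')⟩⟩

end Circle

section Dendrite

variable {D : Type*} [MetricSpace D] [CompactSpace D] [LocallyConnectedSpace D]

/-- In a compact locally connected metric space without circles, interior points of an arc separate
its ends. -/
theorem mem_of_isPreconnected_of_mem_arc (hD : ¬ ∃ S : Set D, Nonempty (S ≃ₜ Circle))
    {γ : ℝ → D} {s r t : ℝ} (hγ : ContinuousOn γ (Icc s t)) (hγi : InjOn γ (Icc s t))
    (hsr : s < r) (hrt : r < t) {S : Set D} (hS : IsPreconnected S) (hs : γ s ∈ S)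
    (ht : γ t ∈ S) : γ r ∈ S := by
  by_contra hr
  let U : Set D := connectedComponentIn {γ r}ᶜ (γ s)
  have hSU : S ⊆ U := hS.subset_connectedComponentIn hs fun x hx hxr => hr (hxr ▸ hx)
  have hU : IsOpen U := isOpen_compl_singleton.connectedComponentIn
  have hUr : γ r ∉ U := fun h => connectedComponentIn_subset _ _ h rfl
  have : ConnectedSpace U := Subtype.connectedSpace
    ⟨⟨_, hSU hs⟩, isPreconnected_connectedComponentIn⟩
  have : LocallyConnectedSpace U := hU.locallyConnectedSpace
  have : PolishSpace U := hU.polishSpace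
  have hst : γ s ≠ γ t := fun h => by
    have := hγi (left_mem_Icc.2 (hsr.trans hrt).le) (right_mem_Icc.2 (hsr.trans hrt).le) h
    linarith
  obtain ⟨A, B, β, hAB, hβ, hβi, hβA, hβB, hβr⟩ : ∃ (A B : ℝ) (β : ℝ → D), A < B ∧
      ContinuousOn β (Icc A B) ∧ InjOn β (Icc A B) ∧ β A = γ s ∧ β B = γ t ∧
      ∀ x, β x ≠ γ r := by
    obtain ⟨A, B, β, hAB, hβ, hβi, hβA, hβB⟩ := exists_arc (a := (⟨γ s, hSU hs⟩ : U))
      (b := ⟨γ t, hSU ht⟩) (by simpa using hst)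
    exact ⟨A, B, fun x => β x, hAB, continuous_subtype_val.comp_continuousOn hβ,
      Subtype.val_injective.comp_injOn hβi, by simp [hβA], by simp [hβB],
      fun x hx => hUr (hx ▸ (β x).2)⟩
  have hcl : ∀ a b, Icc a b ⊆ Icc s t → IsClosed (γ '' Icc a b) := fun a b h =>
    (isCompact_Icc.image_of_continuousOn (hγ.mono h)).isClosed
  have hsub1 : Icc s r ⊆ Icc s t := Icc_subset_Icc_right hrt.le
  have hsub2 : Icc r t ⊆ Icc s t := Icc_subset_Icc_left hsr.le
  obtain ⟨u, ⟨huAB, s', hs', hus⟩, humax⟩ := (isCompact_Icc.of_isClosed_subset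
    (hβ.preimage_isClosed_of_isClosed isClosed_Icc (hcl s r hsub1))
    inter_subset_left).exists_isGreatest
    ⟨A, left_mem_Icc.2 hAB.le, s, left_mem_Icc.2 hsr.le, hβA.symm⟩
  have hβu : ContinuousOn β (Icc u B) := hβ.mono (Icc_subset_Icc_left huAB.1)
  obtain ⟨v, ⟨hvuB, t', ht', hvt⟩, hvmin⟩ := (isCompact_Icc.of_isClosed_subset
    (hβu.preimage_isClosed_of_isClosed isClosed_Icc (hcl r t hsub2))
    inter_subset_left).exists_isLeast
    ⟨B, right_mem_Icc.2 huAB.2, t, right_mem_Icc.2 hrt.le, hβB.symm⟩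
  have hs'r : s' < r := hs'.2.lt_of_ne fun h => hβr u (by rw [← hus, h])
  have hrt' : r < t' := ht'.1.lt_of_ne fun h => hβr v (by rw [← hvt, ← h])
  have huv : u < v := hvuB.1.lt_of_ne fun h => by
    have := hγi (hsub1 hs') (hsub2 ht') (by rw [hus, hvt, h])
    linarith
  have hst' : Icc s' t' ⊆ Icc s t := Icc_subset_Icc hs'.1 ht'.2
  have huvAB : Icc u v ⊆ Icc A B := Icc_subset_Icc huAB.1 hvuB.2
  refine hD (exists_homeomorph_circle_of_arcs (hs'r.trans hrt') huv (hγ.mono hst')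
    (hβ.mono huvAB) (hγi.mono hst') (hβi.mono huvAB) hus hvt ?_)
  rintro x hx ⟨y, hy, hyx⟩
  rcases le_total y r with h | h
  · exact absurd (humax ⟨huvAB ⟨hx.1.le, hx.2.le⟩, y, ⟨hs'.1.trans hy.1, h⟩, hyx⟩)
      (not_le.2 hx.1)
  · exact absurd (hvmin ⟨⟨hx.1.le, hx.2.le.trans hvuB.2⟩, y, ⟨h, hy.2.trans ht'.2⟩, hyx⟩)
      (not_le.2 hx.2)

theorem mem_of_isPreconnected_of_mem_Ioo (hD : ¬ ∃ S : Set D, Nonempty (S ≃ₜ Circle))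
    (γ : C(unitInterval, D)) (hγ : Function.Injective γ) {s r t : unitInterval} (hsr : s < r)
    (hrt : r < t) {S : Set D} (hS : IsPreconnected S) (hs : γ s ∈ S) (ht : γ t ∈ S) :
    γ r ∈ S := by
  let γ' : ℝ → D := fun x => γ (projIcc 0 1 zero_le_one x)
  have hγ' : ∀ x : unitInterval, γ' x = γ x := fun x => by simp [γ']
  have hγc : Continuous γ' := γ.continuous.comp continuous_projIcc
  have hγi : InjOn γ' (Icc s t) := by
    intro x hx y hy hxy
    have hx' : x ∈ Icc (0 : ℝ) 1 := ⟨s.2.1.trans hx.1, hx.2.trans t.2.2⟩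
    have hy' : y ∈ Icc (0 : ℝ) 1 := ⟨s.2.1.trans hy.1, hy.2.trans t.2.2⟩
    have := hγ hxy
    rw [projIcc_of_mem _ hx', projIcc_of_mem _ hy'] at this
    exact congrArg Subtype.val this
  rw [← hγ'] at hs ht ⊢
  exact mem_of_isPreconnected_of_mem_arc hD hγc.continuousOn hγi hsr hrt hS hs ht

/-- The closure of a component of the complement of an arc meets the arc in at most one point. -/
theorem eq_of_mem_closure_connectedComponentIn (hD : ¬ ∃ S : Set D, Nonempty (S ≃ₜ Circle))
    (γ : C(unitInterval, D)) (hγ : Function.Injective γ) {s t : unitInterval} {x : D}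
    (hs : γ s ∈ closure (connectedComponentIn (range γ)ᶜ x))
    (ht : γ t ∈ closure (connectedComponentIn (range γ)ᶜ x)) : s = t := by
  by_contra hne
  wlog hst : s < t generalizing s t
  · exact this ht hs (Ne.symm hne) ((not_lt.1 hst).lt_of_ne (Ne.symm hne))
  obtain ⟨r, hsr, hrt⟩ := exists_between hst
  have hS : IsPreconnected (insert (γ s) (insert (γ t) (connectedComponentIn (range γ)ᶜ x))) :=
    isPreconnected_connectedComponentIn.subset_closure
      ((subset_insert _ _).trans (subset_insert _ _))
      (insert_subset hs (insert_subset ht subset_closure))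
  rcases mem_of_isPreconnected_of_mem_Ioo hD γ hγ hsr hrt hS (by simp) (by simp) with h | h | h
  · exact hsr.ne' (hγ h)
  · exact hrt.ne (hγ h)
  · exact connectedComponentIn_subset _ _ h (mem_range_self r)

/-- Every component of the complement of a nonempty connected closed set contains an end point. -/
theorem exists_mem_endPoints_mem_connectedComponentIn [ConnectedSpace D] {A : Set D}
    (hAc : IsClosed A) (hA : IsConnected A) {x : D} (hx : x ∉ A) :
    ∃ e ∈ endPoints D, e ∈ connectedComponentIn Aᶜ x := by
  obtain ⟨p, hp⟩ := hA.nonempty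
  obtain ⟨e, he, hex⟩ := exists_mem_endPoints_notMem_connectedComponentIn
    (show x ≠ p from fun h => hx (h ▸ hp))
  refine ⟨e, he, ?_⟩
  by_contra hne
  have hAx : A ⊆ {x}ᶜ := subset_compl_singleton_iff.2 hx
  by_cases heA : e ∈ A
  · exact hex (hA.isPreconnected.subset_connectedComponentIn hp hAx heA)
  · have heC : e ∈ connectedComponentIn Aᶜ e := mem_connectedComponentIn heA
    obtain ⟨w, -, hw, hwA⟩ := exists_mem_closure_connectedComponentIn isPreconnected_univ
      hAc.isOpen_compl (mem_univ e) heC (mem_univ p)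
      (fun h => connectedComponentIn_subset _ _ h hp)
    have hC : IsPreconnected (insert w (connectedComponentIn Aᶜ e)) :=
      isPreconnected_connectedComponentIn.subset_closure (subset_insert _ _)
        (insert_subset hw subset_closure)
    have hT := hA.isPreconnected.union w (not_not.1 hwA) (mem_insert _ _) hC
    refine hex (hT.subset_connectedComponentIn (Or.inl hp) ?_ (Or.inr (mem_insert_of_mem _ heC)))
    refine union_subset hAx (insert_subset (hAx (not_not.1 hwA)) ?_)
    refine subset_compl_singleton_iff.2 fun hxC => hne ?_
    rwa [← connectedComponentIn_eq hxC]

end Dendrite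

/-- Let `D` be a dendrite (a nontrivial compact connected locally connected metric
space containing no subset homeomorphic to the circle) whose set of end points is
closed in `D`.  Then every arc in `D` (the image of an injective continuous
`γ : [0,1] → D`, with endpoints `γ 0 ≠ γ 1`) contains a free arc: there are
`u = γ s ≠ v = γ t` in the arc such that the open subarc `(u,v) = γ '' (s,t)`
is an open subset of `D`. -/
theorem arc_contains_free_arc_of_closed_endPoints
    {D : Type*} [MetricSpace D] [CompactSpace D] [ConnectedSpace D]
    [LocallyConnectedSpace D] [Nontrivial D]
    (hD : ¬ ∃ S : Set D, Nonempty (S ≃ₜ Circle))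
    (hE : IsClosed (endPoints D)) :
    ∀ γ : C(unitInterval, D), Function.Injective γ →
      ∃ s t : unitInterval, s < t ∧ IsOpen (γ '' Set.Ioo s t) := by
  intro γ hγ
  by_contra! hopen
  have hAc : IsClosed (range γ) := (isCompact_range γ.continuous).isClosed
  have hA : IsConnected (range γ) := isConnected_range γ.continuous
  let q : unitInterval := ⟨1 / 2, by norm_num, by norm_num⟩
  have hq0 : (0 : unitInterval) < q := Subtype.mk_lt_mk.2 (by norm_num)
  have hq1 : q < 1 := Subtype.mk_lt_mk.2 (by norm_num)
  obtain ⟨t, -, ht, htq⟩ := exists_seq_strictAnti_tendsto' hq1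
  have hex := fun n => exists_mem_closure_connectedComponentIn_of_not_isOpen γ hγ
    (hopen q (t n) (ht n).1)
  choose r hr x hx hrx using hex
  have hrq : Tendsto r atTop (𝓝 q) := tendsto_of_tendsto_of_tendsto_of_le_of_le tendsto_const_nhds
    htq (fun n => (hr n).1.le) fun n => (hr n).2.le
  have hend := fun n => exists_mem_endPoints_mem_connectedComponentIn hAc hA (hx n)
  choose e heE hex using hend
  obtain ⟨z, φ, hφ, hz⟩ := CompactSpace.tendsto_subseq e
  have hrφ : Tendsto (r ∘ φ) atTop (𝓝 q) := hrq.comp hφ.tendsto_atTop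
  by_cases hzA : z ∈ range γ
  · have hγr : Tendsto (fun n => γ (r (φ n))) atTop (𝓝 z) := by
      rw [(LocallyConnectedSpace.open_connected_basis z).tendsto_right_iff]
      rintro V ⟨hVo, hzV, hVc⟩
      filter_upwards [hz (hVo.mem_nhds hzV)] with n hn
      obtain ⟨w, hwV, hw, hwA⟩ := exists_mem_closure_connectedComponentIn hVc.isPreconnected
        hAc.isOpen_compl hn (hex (φ n)) hzV (fun h => connectedComponentIn_subset _ _ h hzA)
      obtain ⟨s, rfl⟩ := not_not.1 hwA
      rwa [eq_of_mem_closure_connectedComponentIn hD γ hγ (hrx (φ n)) hw]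
    have hzq : z = γ q := tendsto_nhds_unique hγr ((γ.continuous.tendsto q).comp hrφ)
    have hqE : IsConnected ({γ q}ᶜ : Set D) :=
      hzq ▸ hE.mem_of_tendsto hz (Eventually.of_forall fun n => heE (φ n))
    exact mem_of_isPreconnected_of_mem_Ioo hD γ hγ hq0 hq1 hqE.isPreconnected
      (fun h => hq0.ne (hγ h)) (fun h => hq1.ne' (hγ h)) rfl
  · have hzC : connectedComponentIn (range γ)ᶜ z ∈ 𝓝 z :=
      hAc.isOpen_compl.connectedComponentIn.mem_nhds (mem_connectedComponentIn hzA)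
    have hC : ∀ᶠ n in atTop, γ (r (φ n)) ∈ closure (connectedComponentIn (range γ)ᶜ z) := by
      filter_upwards [hz hzC] with n hn
      rw [connectedComponentIn_eq hn, Function.comp_apply, ← connectedComponentIn_eq (hex (φ n))]
      exact hrx (φ n)
    obtain ⟨N, hN⟩ := hC.exists
    have hconst : Tendsto (r ∘ φ) atTop (𝓝 (r (φ N))) := by
      refine tendsto_const_nhds.congr' ?_
      filter_upwards [hC] with n hn
      exact eq_of_mem_closure_connectedComponentIn hD γ hγ hN hn
    exact (hr (φ N)).1.ne (tendsto_nhds_unique hrφ hconst)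
end

section
/- There exist a dendrite D, a continuous topologically transitive map f : D → D, and a topological embedding φ : [0,1] → 2^D whose image is contained in the hyperspace of ω-limit sets ω(f). In particular, ω(f) contains an arc and hence is not totally disconnected. -/
open TopologicalSpace Filter Topology

/-- The ω-limit set of a point `x` under a map `f`:
`ω(x,f) = ⋂ₙ cl { f^k(x) : k ≥ n }`. -/
def omegaLimitSet {X : Type*} [TopologicalSpace X] (f : X → X) (x : X) : Set X :=
  ⋂ n : ℕ, closure {y | ∃ k ≥ n, f^[k] x = y}

/-- The hyperspace of ω-limit sets of `f`, as a subset of the hyperspace `2^X`. -/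
def omegaHyperspace {X : Type*} [MetricSpace X] (f : X → X) :
    Set (NonemptyCompacts X) :=
  {A | ∃ x : X, (A : Set X) = omegaLimitSet f x}

/-- A map `f` is topologically transitive if for all nonempty open `U, V` there is
`n ∈ ℕ` (a positive integer) with `f^[n](U) ∩ V ≠ ∅`. -/
def TopTransitive {X : Type*} [TopologicalSpace X] (f : X → X) : Prop :=
  ∀ U V : Set X, IsOpen U → IsOpen V → U.Nonempty → V.Nonempty →
    ∃ n : ℕ, 0 < n ∧ ((f^[n] '' U) ∩ V).Nonempty


/-- Points of the dendrite obtained from a spine `[0,1]` by attaching, at the points `q n`, copies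
of the whole space by their base points `0`, recursively.  A point is recorded by its coordinates
along the spines of all nested copies, the copies being indexed by finite words. -/
def hairyTree (q : ℕ → ℝ) : Set (List ℕ → ℝ) :=
  {y | (∀ w, y w ∈ Set.Icc (0 : ℝ) 1) ∧
    (∀ w n u, y (w ++ n :: u) ≠ 0 → y w = q n) ∧
    ∀ w n m u v, y (w ++ n :: u) ≠ 0 → y (w ++ m :: v) ≠ 0 → n = m}

namespace hairyTree

variable {q : ℕ → ℝ} {a b : List ℕ → ℝ}

lemma isClosed : IsClosed (hairyTree q) := by
  have : hairyTree q = (⋂ w, {y | y w ∈ Set.Icc (0 : ℝ) 1}) ∩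
      ((⋂ w, ⋂ n, ⋂ u, {y | y (w ++ n :: u) * (y w - q n) = 0}) ∩
        ⋂ w, ⋂ n, ⋂ m, ⋂ (_ : n ≠ m), ⋂ u, ⋂ v,
          {y | y (w ++ n :: u) * y (w ++ m :: v) = 0}) := by
    ext y
    simp only [hairyTree, Set.mem_ofPred_eq, Set.mem_inter_iff, Set.mem_iInter, mul_eq_zero,
      sub_eq_zero]
    refine and_congr Iff.rfl (and_congr ?_ ?_)
    · exact forall_congr' fun w => forall_congr' fun n => forall_congr' fun u => by tauto
    · constructor
      · intro h w n m hnm u v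
        by_contra! hc
        exact hnm (h w n m u v hc.1 hc.2)
      · intro h w n m u v h1 h2
        by_contra hnm
        exact (h w n m hnm u v).elim h1 h2
  rw [this]
  refine (isClosed_iInter fun w => isClosed_Icc.preimage (continuous_apply w)).inter
    ((isClosed_iInter fun w => isClosed_iInter fun n => isClosed_iInter fun u => ?_).inter
      (isClosed_iInter fun w => isClosed_iInter fun n => isClosed_iInter fun m =>
        isClosed_iInter fun _ => isClosed_iInter fun u => isClosed_iInter fun v => ?_))
  · exact isClosed_eq (by fun_prop) continuous_const
  · exact isClosed_eq (by fun_prop) continuous_const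

lemma isCompact : IsCompact (hairyTree q) :=
  (isCompact_univ_pi fun _ : List ℕ => isCompact_Icc (a := (0 : ℝ)) (b := 1)).of_isClosed_subset
    isClosed fun _ hy w _ => hy.1 w

instance : CompactSpace (hairyTree q) := isCompact_iff_compactSpace.1 isCompact

lemma nonneg (ha : a ∈ hairyTree q) (w : List ℕ) : 0 ≤ a w := (ha.1 w).1

/-- The pointwise minimum of two points of the tree is their branching point. -/
lemma inf_mem (ha : a ∈ hairyTree q) (hb : b ∈ hairyTree q) : a ⊓ b ∈ hairyTree q := by
  have key : ∀ w, (a ⊓ b) w ≠ 0 → a w ≠ 0 ∧ b w ≠ 0 := by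
    intro w h
    have h1 := nonneg ha w
    have h2 := nonneg hb w
    simp only [Pi.inf_apply] at h
    constructor <;> intro h0 <;> apply h <;> simp [h0, h1, h2]
  refine ⟨fun w => ⟨le_min (ha.1 w).1 (hb.1 w).1, (min_le_left _ _).trans (ha.1 w).2⟩, ?_, ?_⟩
  · intro w n u h
    obtain ⟨h1, h2⟩ := key _ h
    simp [ha.2.1 w n u h1, hb.2.1 w n u h2]
  · intro w n m u v h h'
    exact ha.2.2 w n m u v (key _ h).1 (key _ h').1

lemma sup_mem {c d : List ℕ → ℝ} (ha : a ∈ hairyTree q) (hc : c ∈ hairyTree q)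
    (hd : d ∈ hairyTree q) (hca : c ≤ a) (hda : d ≤ a) : c ⊔ d ∈ hairyTree q := by
  have key : ∀ w, (c ⊔ d) w ≠ 0 → (c w ≠ 0 ∨ d w ≠ 0) ∧ a w ≠ 0 := by
    intro w h
    have h1 := nonneg hc w
    have h2 := nonneg hd w
    have h3 := hca w
    have h4 := hda w
    simp only [Pi.sup_apply] at h
    have : c w ≠ 0 ∨ d w ≠ 0 := by
      by_contra! h0
      simp [h0.1, h0.2] at h
    refine ⟨this, fun h0 => ?_⟩
    rcases this with h' | h'
    · exact h' (le_antisymm (h0 ▸ h3) h1)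
    · exact h' (le_antisymm (h0 ▸ h4) h2)
  refine ⟨fun w => ⟨le_max_of_le_left (hc.1 w).1, max_le (hc.1 w).2 (hd.1 w).2⟩, ?_, ?_⟩
  · intro w n u h
    obtain ⟨h1, h2⟩ := key _ h
    have haw := ha.2.1 w n u h2
    rcases h1 with h1 | h1
    · have := hc.2.1 w n u h1
      rw [Pi.sup_apply, this, ← haw, sup_eq_left.2 (hda w)]
    · have := hd.2.1 w n u h1
      rw [Pi.sup_apply, this, ← haw, sup_eq_right.2 (hca w)]
  · intro w n m u v h h'
    exact ha.2.2 w n m u v (key _ h).2 (key _ h').2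

/-- A cutoff which is `1` at `t = 0`, vanishes at `t = 2`, and is nonzero at level `k + 1` only
where it equals `1` at all lower levels. -/
noncomputable def cutoff (k : ℕ) (t : ℝ) : ℝ := max 0 (min 1 (2 - 2 ^ k * t))

lemma cutoff_mem (k : ℕ) (t : ℝ) : cutoff k t ∈ Set.Icc (0 : ℝ) 1 :=
  ⟨le_max_left _ _, max_le zero_le_one (min_le_left _ _)⟩

lemma cutoff_eq_one {k l : ℕ} (hkl : k < l) {t : ℝ} (ht : 0 ≤ t) (h : cutoff l t ≠ 0) :
    cutoff k t = 1 := by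
  have h1 : 2 ^ l * t < 2 := by
    by_contra! hc
    exact h (max_eq_left ((min_le_right _ _).trans (by linarith)))
  have h2 : (2 : ℝ) ^ (k + 1) ≤ 2 ^ l := pow_le_pow_right₀ (by norm_num) hkl
  have h3 : 2 ^ (k + 1) * t ≤ 2 ^ l * t := mul_le_mul_of_nonneg_right h2 ht
  rw [pow_succ] at h3
  have h4 : (1 : ℝ) ≤ 2 - 2 ^ k * t := by linarith
  simp [cutoff, min_eq_left h4]

@[fun_prop]
lemma continuous_cutoff (k : ℕ) : Continuous (cutoff k) := by
  unfold cutoff; fun_prop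

/-- The path from `a` down to the base point. -/
noncomputable def descend (a : List ℕ → ℝ) (t : ℝ) : List ℕ → ℝ := fun w => a w * cutoff w.length t

lemma descend_le (ha : a ∈ hairyTree q) (t : ℝ) : descend a t ≤ a := fun w =>
  mul_le_of_le_one_right (nonneg ha w) (cutoff_mem _ _).2

lemma descend_mem (ha : a ∈ hairyTree q) {t : ℝ} (ht : 0 ≤ t) : descend a t ∈ hairyTree q := by
  refine ⟨fun w => ⟨mul_nonneg (nonneg ha w) (cutoff_mem _ _).1,
    (descend_le ha t w).trans (ha.1 w).2⟩, ?_, ?_⟩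
  · intro w n u h
    have h1 := left_ne_zero_of_mul h
    have h2 := right_ne_zero_of_mul h
    rw [descend, cutoff_eq_one (by simp) ht h2, mul_one]
    exact ha.2.1 w n u h1
  · intro w n m u v h h'
    exact ha.2.2 w n m u v (left_ne_zero_of_mul h) (left_ne_zero_of_mul h')

/-- Comparable points are joined by a connected set of points between them. -/
lemma exists_isPreconnected_of_le {a m : hairyTree q} (hm : (m : List ℕ → ℝ) ≤ a) :
    ∃ P : Set (hairyTree q), IsPreconnected P ∧ a ∈ P ∧ m ∈ P ∧
      ∀ c ∈ P, (m : List ℕ → ℝ) ≤ c ∧ (c : List ℕ → ℝ) ≤ a := by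
  let γ : Set.Icc (0 : ℝ) 2 → hairyTree q := fun t =>
    ⟨m.1 ⊔ descend a.1 t, sup_mem a.2 m.2 (descend_mem a.2 t.2.1) hm (descend_le a.2 t)⟩
  have hγ : Continuous γ := by
    refine Continuous.subtype_mk (continuous_pi fun w => ?_) _
    simp only [Pi.sup_apply, descend]
    fun_prop
  have : PreconnectedSpace (Set.Icc (0 : ℝ) 2) := Subtype.preconnectedSpace isPreconnected_Icc
  refine ⟨Set.range γ, isPreconnected_range hγ, ⟨⟨0, by norm_num⟩, ?_⟩, ⟨⟨2, by norm_num⟩, ?_⟩, ?_⟩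
  · apply Subtype.ext
    have : descend a.1 0 = a.1 := by ext w; simp [descend, cutoff]
    simpa [γ, this] using hm
  · apply Subtype.ext
    have : descend a.1 2 = 0 := by
      ext w
      have : (1 : ℝ) ≤ 2 ^ w.length := one_le_pow₀ (by norm_num)
      have h : cutoff w.length 2 = 0 :=
        max_eq_left ((min_le_right _ _).trans (by linarith))
      simp [descend, h]
    simp only [γ, this, sup_eq_left]
    exact fun w => nonneg m.2 w
  · rintro _ ⟨t, rfl⟩
    exact ⟨le_sup_left, sup_le hm (descend_le a.2 t)⟩

lemma isPreconnected_of_coordinates (J : List ℕ → Set ℝ) (hJ : ∀ w, (J w).OrdConnected) :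
    IsPreconnected {y : hairyTree q | ∀ w, y.1 w ∈ J w} := by
  refine isPreconnected_of_forall_pair fun a ha b hb => ?_
  let m : hairyTree q := ⟨a.1 ⊓ b.1, inf_mem a.2 b.2⟩
  obtain ⟨P, hP, haP, hmP, hPa⟩ := exists_isPreconnected_of_le (a := a) (m := m) inf_le_left
  obtain ⟨R, hR, hbR, hmR, hRb⟩ := exists_isPreconnected_of_le (a := b) (m := m) inf_le_right
  have hm : ∀ w, m.1 w ∈ J w := by
    intro w
    rcases min_choice (a.1 w) (b.1 w) with h | h
    · simpa [m, h] using ha w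
    · simpa [m, h] using hb w
  refine ⟨P ∪ R, ?_, Or.inl haP, Or.inr hbR, hP.union m hmP hmR hR⟩
  rintro c (hc | hc) w
  · exact (hJ w).out (hm w) (ha w) ⟨(hPa c hc).1 w, (hPa c hc).2 w⟩
  · exact (hJ w).out (hm w) (hb w) ⟨(hRb c hc).1 w, (hRb c hc).2 w⟩

instance : LocallyConnectedSpace (hairyTree q) := by
  rw [locallyConnectedSpace_iff_connected_subsets]
  intro a U hU
  rw [nhds_subtype_eq_comap, nhds_pi, mem_comap] at hU
  obtain ⟨V, hV, hVU⟩ := hU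
  obtain ⟨I, hI, t, ht, htV⟩ := Filter.mem_pi.1 hV
  choose ε hε hεt using fun w => Metric.mem_nhds_iff.1 (ht w)
  classical
  refine ⟨{y | ∀ w, y.1 w ∈ if w ∈ I then Metric.ball (a.1 w) (ε w) else Set.univ}, ?_, ?_, ?_⟩
  · rw [nhds_subtype_eq_comap, nhds_pi, mem_comap]
    refine ⟨I.pi fun w => Metric.ball (a.1 w) (ε w),
      Filter.pi_mem_pi hI fun w _ => Metric.ball_mem_nhds _ (hε w), fun y hy w => ?_⟩
    split_ifs with h
    · exact hy w h
    · trivial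
  · refine isPreconnected_of_coordinates _ fun w => ?_
    split_ifs
    · rw [Real.ball_eq_Ioo]
      exact Set.ordConnected_Ioo
    · exact Set.ordConnected_univ
  · intro y hy
    refine hVU (htV fun w hw => hεt w ?_)
    simpa [hw] using hy w

lemma zero_mem : (0 : List ℕ → ℝ) ∈ hairyTree q :=
  ⟨fun _ => by simp, fun _ _ _ h => absurd rfl h, fun _ _ _ _ _ h => absurd rfl h⟩

instance : ConnectedSpace (hairyTree q) where
  toNonempty := ⟨⟨0, zero_mem⟩⟩
  isPreconnected_univ := by
    simpa using isPreconnected_of_coordinates (q := q) (fun _ => Set.univ)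
      fun _ => Set.ordConnected_univ

/-- A point with a coordinate different from `0` and from all `q n` is determined by it. -/
lemma eq_of_coordinate_eq (ha : a ∈ hairyTree q) (hb : b ∈ hairyTree q) {w : List ℕ} {t : ℝ}
    (h0 : t ≠ 0) (hq : ∀ n, t ≠ q n) (haw : a w = t) (hbw : b w = t) : a = b := by
  have key : ∀ {c : List ℕ → ℝ}, c ∈ hairyTree q → c w = t → ∀ v, ¬ v <+: w → c v = 0 := by
    intro c hc hcw v hv
    by_contra hne
    by_cases hwv : w <+: v
    · obtain ⟨u, rfl⟩ := hwv
      rcases u with _ | ⟨n, u⟩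
      · simp at hv
      · exact hq n (hcw ▸ hc.2.1 w n u hne)
    · obtain ⟨p, n, m, u, v', hnm, h1, h2⟩ : ∃ p n m u v', n ≠ m ∧ w = p ++ n :: u ∧
          v = p ++ m :: v' := by
        clear hcw haw hbw hne
        induction w generalizing v with
        | nil => simp at hwv
        | cons n u ih =>
          rcases v with _ | ⟨m, v⟩
          · simp at hv
          · by_cases hnm : n = m
            · subst hnm
              obtain ⟨p, n', m', u', v', h, rfl, rfl⟩ :=
                ih v (by simpa using hv) (by simpa using hwv)
              exact ⟨n :: p, n', m', u', v', h, rfl, rfl⟩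
            · exact ⟨[], n, m, u, v, hnm, rfl, rfl⟩
      subst h1 h2
      exact hnm (hc.2.2 p n m u v' (hcw ▸ h0) hne)
  ext v
  by_cases hv : v <+: w
  · obtain ⟨u, rfl⟩ := hv
    rcases u with _ | ⟨n, u⟩
    · simp only [List.append_nil] at haw hbw
      rw [haw, hbw]
    · rw [ha.2.1 v n u (haw ▸ h0), hb.2.1 v n u (hbw ▸ h0)]
  · rw [key ha haw v hv, key hb hbw v hv]

end hairyTree

lemma Circle.isPreconnected_compl_singleton (c : Circle) : IsPreconnected ({c}ᶜ : Set Circle) := by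
  have : ({c}ᶜ : Set Circle) =
      (fun θ : ℝ => c * Circle.exp Real.pi * Circle.exp θ) '' Set.Ioo (-Real.pi) Real.pi := by
    ext x
    have hpi : Circle.exp Real.pi * Circle.exp Real.pi = 1 := by
      rw [← Circle.exp_add, ← two_mul, Circle.exp_two_pi]
    constructor
    · intro hx
      refine ⟨Complex.arg (x * (c * Circle.exp Real.pi)⁻¹ : Circle), ⟨Complex.neg_pi_lt_arg _,
        lt_of_le_of_ne (Complex.arg_le_pi _) fun h => hx ?_⟩, ?_⟩
      · have h2 := Circle.exp_arg (x * (c * Circle.exp Real.pi)⁻¹)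
        rw [h] at h2
        have : x = Circle.exp Real.pi * (c * Circle.exp Real.pi) := eq_mul_of_mul_inv_eq h2.symm
        rw [mul_left_comm, hpi, mul_one] at this
        exact this
      · simp only [Circle.exp_arg]
        rw [mul_comm, inv_mul_cancel_right]
    · rintro ⟨θ, hθ, rfl⟩ h
      have h1 : Circle.exp Real.pi * Circle.exp θ = 1 := by
        simpa [mul_assoc] using h
      have h2 : Circle.exp θ = Circle.exp Real.pi := by
        rw [← hpi] at h1
        exact mul_left_cancel h1
      have h3 := congrArg (fun z : Circle => Complex.arg z) h2
      simp only [Circle.arg_exp hθ.1 hθ.2.le, Circle.arg_exp (by linarith [Real.pi_pos]) le_rfl]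
        at h3
      exact hθ.2.ne h3
  rw [this]
  exact isPreconnected_Ioo.image _ (by fun_prop)

/-- A real function on the circle takes intermediate values at least twice. -/
lemma Circle.not_subsingleton_preimage {g : Circle → ℝ} (hg : Continuous g) {x y : Circle} {t : ℝ}
    (hx : g x < t) (hy : t < g y) : ¬ (g ⁻¹' {t}).Subsingleton := by
  intro h
  have hpre : IsPreconnected (g ⁻¹' {t})ᶜ := by
    rcases h.eq_empty_or_singleton with h | ⟨c, h⟩
    · rw [h, Set.compl_empty]
      have h2 := isPreconnected_range Circle.exp.continuous
      rwa [Circle.exp_surjective.range_eq] at h2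
    · rw [h]
      exact Circle.isPreconnected_compl_singleton c
  obtain ⟨z, hz, hzt⟩ := (hpre.image g hg.continuousOn).ordConnected.out
    ⟨x, hx.ne, rfl⟩ ⟨y, hy.ne', rfl⟩ ⟨hx.le, hy.le⟩
  exact hz hzt

lemma hairyTree.not_homeomorph_circle {q : ℕ → ℝ} :
    ¬ ∃ S : Set (hairyTree q), Nonempty (S ≃ₜ Circle) := by
  rintro ⟨S, ⟨h⟩⟩
  let G : List ℕ → Circle → ℝ := fun w z => (h.symm z).1.1 w
  have hG : ∀ w, Continuous (G w) := fun w =>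
    (continuous_apply w).comp (continuous_subtype_val.comp
      (continuous_subtype_val.comp h.symm.continuous))
  have hne : h.symm 1 ≠ h.symm (Circle.exp Real.pi) := by
    intro he
    have h1 := congrArg (fun z : Circle => Complex.arg z) (h.symm.injective he)
    simp only [Circle.arg_exp (by linarith [Real.pi_pos] : -Real.pi < Real.pi) le_rfl] at h1
    simp at h1
    exact Real.pi_ne_zero h1.symm
  obtain ⟨w, x, y, hlt⟩ : ∃ w x y, G w x < G w y := by
    by_contra! hc
    exact hne (Subtype.ext (Subtype.ext (funext fun w => le_antisymm (hc w _ _) (hc w _ _))))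
  obtain ⟨t, ⟨ht1, ht2⟩, htq⟩ : ∃ t ∈ Set.Ioo (G w x) (G w y), t ∈ (Set.range q)ᶜ := by
    have := ((Set.countable_range q).dense_compl ℝ).exists_mem_open isOpen_Ioo
      (Set.nonempty_Ioo.2 hlt)
    obtain ⟨t, h1, h2⟩ := this
    exact ⟨t, h2, h1⟩
  refine Circle.not_subsingleton_preimage (hG w) ht1 ht2 fun z hz z' hz' => h.symm.injective ?_
  refine Subtype.ext (Subtype.ext (eq_of_coordinate_eq (h.symm z).1.2 (h.symm z').1.2 (t := t)
    ?_ (fun n hn => htq ⟨n, hn.symm⟩) hz hz'))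
  exact ((nonneg (h.symm x).1.2 w).trans_lt ht1).ne'

/-- Combinatorial data defining a self-map of `hairyTree q`: it is the identity on the spine, maps
the spine of the copy `n` into the spine by `s n`, and maps the copy `m` inside the copy `n` onto
the copy `σ n m`. -/
structure HairDynamics (q : ℕ → ℝ) where
  /-- The map on the spine of the `n`-th copy. -/
  s : ℕ → ℝ → ℝ
  /-- The image of the `m`-th copy inside the `n`-th one. -/
  σ : ℕ → ℕ → ℕ
  q_mem : ∀ n, q n ∈ Set.Icc (0 : ℝ) 1
  q_dense : ∀ x ∈ Set.Icc (0 : ℝ) 1, ∀ ε > 0, ∃ n, |q n - x| < ε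
  s_cont : ∀ n, Continuous (s n)
  s_mem : ∀ n, ∀ x ∈ Set.Icc (0 : ℝ) 1, s n x ∈ Set.Icc (0 : ℝ) 1
  s_zero : ∀ n, s n 0 = q n
  s_small : ∀ ε > 0, ∃ N, ∀ n ≥ N, ∀ x ∈ Set.Icc (0 : ℝ) 1, |s n x - q n| < ε
  q_σ : ∀ n m, q (σ n m) = s n (q m)
  finite_σ : ∀ k, {p : ℕ × ℕ | σ p.1 p.2 = k}.Finite
  s_root : ∀ x, s 0 x = x
  σ_root : ∀ m, σ 0 m = m
  exists_σ_succ : ∀ n, ∃ m, σ (n + 1) m = n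

namespace HairDynamics

variable {q : ℕ → ℝ} (d : HairDynamics q)

/-- The self-map of the tree, in coordinates.  At most one term of each sum is nonzero. -/
noncomputable def rawMap (y : List ℕ → ℝ) : List ℕ → ℝ
  | [] => y [] + ∑' n, (d.s n (y [n]) - q n)
  | k :: r => ∑ p ∈ (d.finite_σ k).toFinset, y (p.1 :: p.2 :: r)

/-- The embedding of the whole tree as its `n`-th copy. -/
def _root_.hairyTree.rawGraft (q : ℕ → ℝ) (n : ℕ) (y : List ℕ → ℝ) : List ℕ → ℝ
  | [] => q n
  | k :: r => if k = n then y r else 0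

open hairyTree

lemma _root_.hairyTree.exists_support {y : List ℕ → ℝ} (hy : y ∈ hairyTree q) :
    ∃ n, ∀ m u, y (m :: u) ≠ 0 → m = n := by
  by_cases h : ∃ n u, y (n :: u) ≠ 0
  · obtain ⟨n, u, hn⟩ := h
    exact ⟨n, fun m v hm => hy.2.2 [] m n v u hm hn⟩
  · push Not at h
    exact ⟨0, fun m u hm => absurd (h m u) hm⟩

lemma term_eq_zero {y : List ℕ → ℝ} {n : ℕ} (hn : ∀ m, y [m] ≠ 0 → m = n) (m : ℕ)
    (hm : m ≠ n) : d.s m (y [m]) - q m = 0 := by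
  have : y [m] = 0 := by
    by_contra h
    exact hm (hn m h)
  rw [this, d.s_zero, sub_self]

lemma tsum_eq {y : List ℕ → ℝ} {n : ℕ} (hn : ∀ m, y [m] ≠ 0 → m = n) :
    ∑' n, (d.s n (y [n]) - q n) = d.s n (y [n]) - q n :=
  tsum_eq_single n (d.term_eq_zero hn)

lemma rawMap_nil {y : List ℕ → ℝ} {n : ℕ} (hn : ∀ m, y [m] ≠ 0 → m = n) :
    d.rawMap y [] = y [] + (d.s n (y [n]) - q n) := by
  rw [rawMap, d.tsum_eq hn]

lemma rawMap_cons {y : List ℕ → ℝ} (hy : y ∈ hairyTree q) {n m : ℕ} {u : List ℕ}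
    (h : y (n :: m :: u) ≠ 0) (r : List ℕ) : d.rawMap y (d.σ n m :: r) = y (n :: m :: r) := by
  refine Finset.sum_eq_single (n, m) ?_ fun hmem => absurd (by simp) hmem
  rintro ⟨n', m'⟩ - hne
  by_contra h'
  obtain rfl := hy.2.2 [] n n' _ _ h h'
  obtain rfl := hy.2.2 [n] m m' _ _ h h'
  exact hne rfl

lemma exists_of_rawMap_ne_zero {y : List ℕ → ℝ} {k : ℕ} {r : List ℕ}
    (h : d.rawMap y (k :: r) ≠ 0) : ∃ n m, d.σ n m = k ∧ y (n :: m :: r) ≠ 0 := by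
  obtain ⟨p, hp, hne⟩ := Finset.exists_ne_zero_of_sum_ne_zero h
  exact ⟨p.1, p.2, by simpa using hp, hne⟩

lemma rawMap_mem {y : List ℕ → ℝ} (hy : y ∈ hairyTree q) : d.rawMap y ∈ hairyTree q := by
  refine ⟨?_, ?_, ?_⟩
  · rintro (_ | ⟨k, r⟩)
    · obtain ⟨n, hn⟩ := exists_support hy
      rw [d.rawMap_nil fun m hm => hn m [] hm]
      by_cases h : y [n] = 0
      · simpa [h, d.s_zero] using hy.1 []
      · rw [hy.2.1 [] n [] h, add_sub_cancel]
        exact d.s_mem n _ (hy.1 _)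
    · by_cases h : d.rawMap y (k :: r) = 0
      · simp [h]
      · obtain ⟨n, m, rfl, hne⟩ := d.exists_of_rawMap_ne_zero h
        rw [d.rawMap_cons hy hne]
        exact hy.1 _
  · rintro (_ | ⟨l, w⟩) k u h
    · obtain ⟨n, m, rfl, hne⟩ := d.exists_of_rawMap_ne_zero h
      rw [d.rawMap_nil fun n' h' => hy.2.2 [] n' n _ _ h' hne, hy.2.1 [] n _ hne,
        hy.2.1 [n] m _ hne, d.q_σ, add_sub_cancel]
    · obtain ⟨n, m, rfl, hne⟩ := d.exists_of_rawMap_ne_zero h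
      rw [d.rawMap_cons hy hne]
      exact hy.2.1 (n :: m :: w) k u hne
  · rintro (_ | ⟨l, w⟩) k k' u v h h'
    · obtain ⟨n, m, rfl, hne⟩ := d.exists_of_rawMap_ne_zero h
      obtain ⟨n', m', rfl, hne'⟩ := d.exists_of_rawMap_ne_zero h'
      obtain rfl := hy.2.2 [] n n' _ _ hne hne'
      obtain rfl := hy.2.2 [n] m m' _ _ hne hne'
      rfl
    · obtain ⟨n, m, rfl, hne⟩ := d.exists_of_rawMap_ne_zero h
      obtain ⟨n', m', -, hne'⟩ := d.exists_of_rawMap_ne_zero h'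
      obtain rfl := hy.2.2 [] n n' _ _ hne hne'
      obtain rfl := hy.2.2 [n] m m' _ _ hne hne'
      exact hy.2.2 (n :: m :: w) k k' u v hne hne'

@[fun_prop]
lemma _root_.hairyTree.continuous_coordinate (w : List ℕ) :
    Continuous fun y : hairyTree q => y.1 w :=
  (continuous_apply w).comp continuous_subtype_val

/-- The self-map of the tree determined by `d`. -/
noncomputable def map (y : hairyTree q) : hairyTree q := ⟨d.rawMap y, d.rawMap_mem y.2⟩

lemma continuous_map : Continuous d.map := by
  refine Continuous.subtype_mk (continuous_pi ?_) _
  rintro (_ | ⟨k, r⟩)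
  · refine Continuous.add (by fun_prop) (continuous_of_uniform_approx_of_continuous fun V hV => ?_)
    obtain ⟨ε, hε, hεV⟩ := Metric.mem_uniformity_dist.1 hV
    obtain ⟨N, hN⟩ := d.s_small ε hε
    refine ⟨fun y => ∑ n ∈ Finset.range N, (d.s n (y.1 [n]) - q n), ?_, fun y => hεV ?_⟩
    · refine continuous_finsetSum _ fun n _ => ((d.s_cont n).comp ?_).sub continuous_const
      fun_prop
    · obtain ⟨n, hn⟩ := exists_support y.2
      have hsum := d.term_eq_zero fun m => hn m []
      rw [d.tsum_eq fun m => hn m []]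
      beta_reduce
      by_cases hnN : n < N
      · rw [Finset.sum_eq_single n (fun m _ => hsum m)
          (fun h => absurd (Finset.mem_range.2 hnN) h), dist_self]
        exact hε
      · rw [Finset.sum_eq_zero fun m hm => hsum m ?_, dist_zero_right, Real.norm_eq_abs]
        · exact hN n (not_lt.1 hnN) _ (y.2.1 _)
        · rintro rfl
          exact hnN (Finset.mem_range.1 hm)
  · refine continuous_finsetSum _ fun p _ => ?_
    fun_prop

lemma _root_.hairyTree.rawGraft_mem (hq : ∀ n, q n ∈ Set.Icc (0 : ℝ) 1) {y : List ℕ → ℝ} (hy : y ∈ hairyTree q)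
    (n : ℕ) : rawGraft q n y ∈ hairyTree q := by
  have key : ∀ k r, rawGraft q n y (k :: r) ≠ 0 → k = n ∧ y r ≠ 0 := by
    intro k r h
    simpa [rawGraft] using h
  refine ⟨?_, ?_, ?_⟩
  · rintro (_ | ⟨k, r⟩)
    · exact hq n
    · simp only [rawGraft]
      split_ifs
      · exact hy.1 r
      · simp
  · rintro (_ | ⟨l, w⟩) k u h
    · obtain ⟨rfl, -⟩ := key _ _ h
      rfl
    · obtain ⟨rfl, hne⟩ := key l (w ++ k :: u) h
      simpa [rawGraft] using hy.2.1 w k u hne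
  · rintro (_ | ⟨l, w⟩) k k' u v h h'
    · rw [(key _ _ h).1, (key _ _ h').1]
    · exact hy.2.2 w k k' u v (key _ _ h).2 (key _ _ h').2

/-- The embedding of the whole tree as its `n`-th copy. -/
def graft (n : ℕ) (y : hairyTree q) : hairyTree q := ⟨rawGraft q n y, rawGraft_mem d.q_mem y.2 n⟩

lemma map_graft_graft (n m : ℕ) (y : hairyTree q) :
    d.map (d.graft n (d.graft m y)) = d.graft (d.σ n m) y := by
  apply Subtype.ext
  ext (_ | ⟨k, r⟩)
  · change d.rawMap (rawGraft q n (rawGraft q m y)) [] = _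
    rw [d.rawMap_nil (n := n) fun m' h => by by_contra hc; simp [rawGraft, hc] at h]
    simp [rawGraft, graft, d.q_σ]
  · change ∑ p ∈ (d.finite_σ k).toFinset, _ = if k = d.σ n m then _ else _
    have : ∀ p : ℕ × ℕ, (d.graft n (d.graft m y)).1 (p.1 :: p.2 :: r) =
        if p = (n, m) then y.1 r else 0 := by
      rintro ⟨a, b⟩
      by_cases ha : a = n <;> by_cases hb : b = m <;> simp [graft, rawGraft, ha, hb]
    simp only [this, Finset.sum_ite_eq', Set.Finite.mem_toFinset, Set.mem_ofPred_eq, eq_comm]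

lemma map_graft_root (y : hairyTree q) : d.map (d.graft 0 y) = y := by
  apply Subtype.ext
  ext (_ | ⟨k, r⟩)
  · change d.rawMap (rawGraft q 0 y) [] = _
    rw [d.rawMap_nil (n := 0) fun m' h => by by_contra hc; simp [rawGraft, hc] at h]
    simp [rawGraft, d.s_root]
  · change ∑ p ∈ (d.finite_σ k).toFinset, _ = _
    rw [Finset.sum_eq_single (0, k)]
    · simp [graft, rawGraft]
    · rintro ⟨a, b⟩ hab hne
      by_cases ha : a = 0
      · subst ha
        simp [d.σ_root] at hab
        exact absurd (by rw [hab]) hne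
      · simp [graft, rawGraft, ha]
    · intro h
      simp [d.σ_root] at h

lemma exists_iterate_graft_word (w : List ℕ) (n : ℕ) :
    ∃ j k, ∀ y, d.map^[j] (d.graft n (w.foldr d.graft y)) = d.graft k y := by
  induction w generalizing n with
  | nil => exact ⟨0, n, fun y => rfl⟩
  | cons m w ih =>
    obtain ⟨j, k, h⟩ := ih (d.σ n m)
    refine ⟨j + 1, k, fun y => ?_⟩
    rw [Function.iterate_succ_apply, List.foldr_cons, map_graft_graft, h]

lemma exists_iterate_graft_eq (k : ℕ) (y : hairyTree q) :
    ∃ z, d.map^[k + 1] (d.graft k z) = y := by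
  induction k with
  | zero => exact ⟨y, d.map_graft_root y⟩
  | succ k ih =>
    obtain ⟨z, hz⟩ := ih
    obtain ⟨m, hm⟩ := d.exists_σ_succ k
    exact ⟨d.graft m z, by rw [Function.iterate_succ_apply, map_graft_graft, hm, hz]⟩

/-- Every point is nearly in some copy. -/
lemma exists_near_graft (y : hairyTree q) {ε : ℝ} (hε : 0 < ε) :
    ∃ n z, ∀ v, |(d.graft n z).1 v - y.1 v| < ε := by
  by_cases h : ∃ n u, y.1 (n :: u) ≠ 0
  · obtain ⟨n, u, hn⟩ := h
    have hz : (fun r => y.1 (n :: r)) ∈ hairyTree q :=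
      ⟨fun w => y.2.1 _, fun w => y.2.2.1 (n :: w), fun w => y.2.2.2 (n :: w)⟩
    refine ⟨n, ⟨_, hz⟩, ?_⟩
    rintro (_ | ⟨k, r⟩)
    · simpa [graft, rawGraft, y.2.2.1 [] n u hn] using hε
    · by_cases hk : k = n
      · simpa [graft, rawGraft, hk] using hε
      · have : y.1 (k :: r) = 0 := by
          by_contra hc
          exact hk (y.2.2.2 [] k n r u hc hn)
        simpa [graft, rawGraft, hk, this] using hε
  · push Not at h
    obtain ⟨n, hn⟩ := d.q_dense _ (y.2.1 []) ε hε
    refine ⟨n, ⟨0, zero_mem⟩, ?_⟩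
    rintro (_ | ⟨k, r⟩)
    · exact hn
    · simpa [graft, rawGraft, h] using hε

lemma exists_word_near (L : ℕ) (y : hairyTree q) {ε : ℝ} (hε : 0 < ε) :
    ∃ w : List ℕ, w.length = L ∧ ∀ z, ∀ v : List ℕ, v.length < L →
      |(w.foldr d.graft z).1 v - y.1 v| < ε := by
  induction L generalizing y ε with
  | zero => exact ⟨[], rfl, fun z v hv => absurd hv (Nat.not_lt_zero _)⟩
  | succ L ih =>
    obtain ⟨n, y', hy'⟩ := d.exists_near_graft y (half_pos hε)
    obtain ⟨w, hw, hwz⟩ := ih y' (half_pos hε)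
    refine ⟨n :: w, by simp [hw], fun z v hv => ?_⟩
    have h1 := hy' v
    have h2 : |((n :: w).foldr d.graft z).1 v - (d.graft n y').1 v| < ε / 2 := by
      rcases v with _ | ⟨k, r⟩
      · simpa [graft, rawGraft] using half_pos hε
      · by_cases hk : k = n
        · simpa [graft, rawGraft, hk] using hwz z r (by simpa using hv)
        · simpa [graft, rawGraft, hk] using half_pos hε
    calc _ ≤ _ := abs_sub_le _ ((d.graft n y').1 v) _
      _ < ε := by linarith

lemma exists_word_mem {U : Set (hairyTree q)} (hU : IsOpen U) (hne : U.Nonempty) :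
    ∃ (n : ℕ) (w : List ℕ), ∀ z, d.graft n (w.foldr d.graft z) ∈ U := by
  obtain ⟨y, hy⟩ := hne
  have hUy := hU.mem_nhds hy
  rw [nhds_subtype_eq_comap, nhds_pi, mem_comap] at hUy
  obtain ⟨V, hV, hVU⟩ := hUy
  obtain ⟨I, hI, t, ht, htV⟩ := Filter.mem_pi.1 hV
  choose ε hε hεt using fun w => Metric.mem_nhds_iff.1 (ht w)
  obtain ⟨δ, hδ, hδε⟩ : ∃ δ > 0, ∀ w ∈ I, δ ≤ ε w :=
    ((hI.eventually_all (l := 𝓝[>] (0 : ℝ)) (p := fun w δ => δ ≤ ε w)).2 fun w _ =>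
      (eventually_le_nhds (hε w)).filter_mono nhdsWithin_le_nhds).and
        self_mem_nhdsWithin |>.exists.imp fun δ h => ⟨h.2, h.1⟩
  obtain ⟨L, hL⟩ : ∃ L, ∀ w ∈ I, w.length ≤ L := by
    obtain ⟨L, hL⟩ := (hI.image List.length).bddAbove
    exact ⟨L, fun w hw => hL ⟨w, hw, rfl⟩⟩
  obtain ⟨w, hw, hwz⟩ := d.exists_word_near (L + 1) y hδ
  rcases w with _ | ⟨n, w⟩
  · simp at hw
  · refine ⟨n, w, fun z => hVU (htV fun v hv => hεt v ?_)⟩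
    exact (hwz z v (Nat.lt_succ_of_le (hL v hv))).trans_le (hδε v hv)

/-- Every nonempty open set is eventually mapped onto the whole tree. -/
lemma exists_iterate_image_eq_univ {U : Set (hairyTree q)} (hU : IsOpen U) (hne : U.Nonempty) :
    ∃ n, 0 < n ∧ d.map^[n] '' U = Set.univ := by
  obtain ⟨n, w, h⟩ := d.exists_word_mem hU hne
  obtain ⟨j, k, hj⟩ := d.exists_iterate_graft_word w n
  refine ⟨k + 1 + j, by omega, Set.eq_univ_of_forall fun y => ?_⟩
  obtain ⟨z, hz⟩ := d.exists_iterate_graft_eq k y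
  exact ⟨_, h z, by rw [Function.iterate_add_apply, hj, hz]⟩

/-- The point of the spine with parameter `t`. -/
def spine (q : ℕ → ℝ) (t : unitInterval) : hairyTree q :=
  ⟨fun w => if w = [] then t else 0, fun w => by beta_reduce; split_ifs <;> simp,
    fun w n u h => by simp at h, fun w n m u v h => by simp at h⟩

lemma continuous_spine : Continuous (spine q) := by
  refine Continuous.subtype_mk (continuous_pi fun w => ?_) _
  by_cases h : w = [] <;> simp [h] <;> fun_prop

lemma spine_injective : Function.Injective (spine q) := fun s t h => by
  have := congrFun (congrArg Subtype.val h) []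
  exact Subtype.ext (by simpa [spine] using this)

lemma map_spine (t : unitInterval) : d.map (spine q t) = spine q t := by
  apply Subtype.ext
  ext (_ | ⟨k, r⟩)
  · change d.rawMap _ [] = _
    rw [d.rawMap_nil (n := 0) fun m h => by simp [spine] at h]
    simp [spine, d.s_zero]
  · change ∑ p ∈ (d.finite_σ k).toFinset, _ = _
    simp [spine]

end HairDynamics

/-- The sequence sweeping `[0,1]` up and down, with steps `1 / b` on `[b², (b + 1)²]`. -/
noncomputable def zigzag (n : ℕ) : ℝ :=
  min ((n : ℝ) - n.sqrt ^ 2) (n.sqrt ^ 2 + 2 * n.sqrt - n) / n.sqrt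

lemma zigzag_add {b j : ℕ} (hj : j ≤ 2 * b) :
    zigzag (b ^ 2 + j) = min (j : ℝ) (2 * b - j) / b := by
  rw [zigzag, Nat.sqrt_add_eq' b (by omega)]
  push_cast
  congr 2 <;> ring

lemma exists_eq_sq_add (n : ℕ) : ∃ b j, j ≤ 2 * b ∧ n = b ^ 2 + j ∧ b = n.sqrt := by
  have h1 := Nat.sqrt_le' n
  have h2 := Nat.sqrt_le_add n
  refine ⟨n.sqrt, n - n.sqrt ^ 2, ?_, by omega, rfl⟩
  rw [sq]
  omega

lemma zigzag_eq_rat (n : ℕ) : ∃ r : ℚ, zigzag n = r ∧ r ∈ Set.Icc (0 : ℚ) 1 := by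
  obtain ⟨b, j, hj, rfl, -⟩ := exists_eq_sq_add n
  rw [zigzag_add hj]
  have hj' : (j : ℚ) ≤ 2 * b := by exact_mod_cast hj
  refine ⟨min (j : ℚ) (2 * b - j) / b, by push_cast; rfl, ?_, ?_⟩
  · exact div_nonneg (le_min (by positivity) (by linarith)) (by positivity)
  · refine div_le_one_of_le₀ ?_ (by positivity)
    rcases le_total (j : ℚ) b with h | h
    · exact (min_le_left _ _).trans h
    · exact (min_le_right _ _).trans (by linarith)

lemma zigzag_mem (n : ℕ) : zigzag n ∈ Set.Icc (0 : ℝ) 1 := by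
  obtain ⟨r, hr, h0, h1⟩ := zigzag_eq_rat n
  rw [hr]
  exact ⟨by exact_mod_cast h0, by exact_mod_cast h1⟩

lemma exists_zigzag_eq {r : ℚ} (hr : r ∈ Set.Icc (0 : ℚ) 1) (K : ℕ) :
    ∃ k ≥ K, zigzag k = r := by
  have hnum : 0 ≤ r.num := Rat.num_nonneg.2 hr.1
  obtain ⟨a, ha⟩ := Int.eq_ofNat_of_zero_le hnum
  have hden : 0 < r.den := r.pos
  have hr' : r = a / r.den := by
    conv_lhs => rw [← Rat.num_div_den r, ha]
    simp
  have had : a ≤ r.den := by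
    have h1 := hr.2
    rw [hr', div_le_one (by exact_mod_cast hden)] at h1
    exact_mod_cast h1
  set c := r.den
  have hac : a * (K + 1) ≤ c * (K + 1) := Nat.mul_le_mul_right _ had
  refine ⟨(c * (K + 1)) ^ 2 + a * (K + 1), ?_, ?_⟩
  · have h1 : K + 1 ≤ c * (K + 1) := Nat.le_mul_of_pos_left _ hden
    have h2 := Nat.le_self_pow two_ne_zero (c * (K + 1))
    omega
  · rw [zigzag_add (by omega), min_eq_left, hr']
    · push_cast
      field_simp
    · have : ((a * (K + 1) : ℕ) : ℝ) ≤ (c * (K + 1) : ℕ) := by exact_mod_cast hac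
      linarith

lemma zigzag_zero : zigzag 0 = 0 := by simp [zigzag]

lemma zigzag_two : zigzag 2 = 1 := by
  have := zigzag_add (b := 1) (j := 1) (by norm_num)
  norm_num at this
  exact this

lemma abs_zigzag_succ_sub_le (n : ℕ) : |zigzag (n + 1) - zigzag n| ≤ 1 / n.sqrt := by
  obtain ⟨b, j, hj, hn, hb⟩ := exists_eq_sq_add n
  rw [← hb]
  rcases hj.lt_or_eq with h | h
  · rw [hn, add_assoc, zigzag_add hj, zigzag_add (by omega), ← sub_div, abs_div, Nat.abs_cast]
    gcongr
    refine (abs_min_sub_min_le_max _ _ _ _).trans (max_le ?_ ?_)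
    · simp
    · rw [abs_le]
      push_cast
      constructor <;> linarith
  · have h1 : n + 1 = (b + 1) ^ 2 + 0 := by rw [hn, h]; ring
    rw [h1, zigzag_add (by omega), hn, zigzag_add hj, h]
    have h2 : (0 : ℝ) ≤ 2 * (b + 1) := by positivity
    simp [min_eq_left h2]

lemma exists_σ (n m : ℕ) : ∃ k ≥ n + m,
    zigzag k = zigzag n + zigzag m * (zigzag (n - 1) - zigzag n) := by
  obtain ⟨a, ha, ha0, ha1⟩ := zigzag_eq_rat n
  obtain ⟨b, hb, hb0, hb1⟩ := zigzag_eq_rat m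
  obtain ⟨c, hc, hc0, hc1⟩ := zigzag_eq_rat (n - 1)
  rw [ha, hb, hc]
  obtain ⟨k, hk, h⟩ := exists_zigzag_eq (r := a + b * (c - a))
    ⟨by nlinarith, by nlinarith⟩ (n + m)
  exact ⟨k, hk, by rw [h]; push_cast; ring⟩

/-- The dynamics in which the `n + 1`-st copy is mapped over the `n`-th one. -/
noncomputable def zigzagDynamics : HairDynamics zigzag where
  s n x := if n = 0 then x else zigzag n + x * (zigzag (n - 1) - zigzag n)
  σ n m := if n = 0 then m else if m = 2 then n - 1 else (exists_σ n m).choose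
  q_mem := zigzag_mem
  q_dense x hx ε hε := by
    have h1 : ∃ r : ℚ, r ∈ Set.Icc (0 : ℚ) 1 ∧ |(r : ℝ) - x| < ε := by
      have hlt : max 0 (x - ε) < min 1 (x + ε) := by
        rw [max_lt_iff, lt_min_iff, lt_min_iff]
        refine ⟨⟨zero_lt_one, ?_⟩, ?_, ?_⟩ <;> linarith [hx.1, hx.2]
      obtain ⟨r, hr1, hr2⟩ := exists_rat_btwn hlt
      rw [max_lt_iff] at hr1
      rw [lt_min_iff] at hr2
      refine ⟨r, ⟨by exact_mod_cast hr1.1.le, by exact_mod_cast hr2.1.le⟩, ?_⟩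
      rw [abs_lt]
      constructor <;> linarith
    obtain ⟨r, hr, hrx⟩ := h1
    obtain ⟨k, -, hk⟩ := exists_zigzag_eq hr 0
    exact ⟨k, hk ▸ hrx⟩
  s_cont n := by split_ifs <;> fun_prop
  s_mem n x hx := by
    split_ifs
    · exact hx
    · obtain ⟨h1, h2⟩ := zigzag_mem n
      obtain ⟨h3, h4⟩ := zigzag_mem (n - 1)
      obtain ⟨h5, h6⟩ := hx
      constructor <;> nlinarith
  s_zero n := by
    split_ifs with h
    · rw [h, zigzag_zero]
    · simp
  s_small ε hε := by
    obtain ⟨N, hN⟩ := exists_nat_one_div_lt hε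
    refine ⟨(N + 1) ^ 2 + 1, fun n hn x hx => ?_⟩
    obtain ⟨n, rfl⟩ : ∃ k, n = k + 1 := ⟨n - 1, by omega⟩
    have h1 := abs_zigzag_succ_sub_le n
    have h2 : N + 1 ≤ n.sqrt := Nat.le_sqrt'.2 (by omega)
    have h3 : (1 : ℝ) / n.sqrt ≤ 1 / (N + 1) := by
      gcongr
      exact_mod_cast h2
    simp only [Nat.add_eq_zero_iff, one_ne_zero, and_false, if_false, add_sub_cancel_left,
      Nat.add_sub_cancel]
    rw [abs_mul, abs_sub_comm, abs_of_nonneg hx.1]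
    calc x * |zigzag (n + 1) - zigzag n| ≤ 1 * |zigzag (n + 1) - zigzag n| := by
          gcongr
          exact hx.2
      _ < ε := by linarith
  q_σ n m := by
    split_ifs with h1 h2
    · rfl
    · rw [h2, zigzag_two]
      ring
    · exact (exists_σ n m).choose_spec.2
  finite_σ k := by
    refine ((Set.finite_Iic (k + 2)).prod (Set.finite_Iic (k + 2))).subset ?_
    rintro ⟨n, m⟩ h
    simp only [Set.mem_ofPred_eq] at h
    simp only [Set.mem_prod, Set.mem_Iic]
    split_ifs at h with h1 h2
    · omega
    · omega
    · have := (exists_σ n m).choose_spec.1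
      omega
  s_root x := by simp
  σ_root m := by simp
  exists_σ_succ n := ⟨2, by simp⟩

lemma omegaLimitSet_of_fixed {X : Type*} [TopologicalSpace X] [T1Space X] {f : X → X} {x : X}
    (h : f x = x) : omegaLimitSet f x = {x} := by
  have : ∀ n : ℕ, {y | ∃ k ≥ n, f^[k] x = y} = {x} := fun n => by
    ext y
    simp only [Function.iterate_fixed h, Set.mem_ofPred_eq, Set.mem_singleton_iff]
    exact ⟨fun ⟨_, _, h⟩ => h.symm, fun h => ⟨n, le_rfl, h.symm⟩⟩
  simp [omegaLimitSet, this, Set.iInter_const]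

lemma isEmbedding_singleton_comp {X : Type*} [MetricSpace X] {γ : unitInterval → X}
    (hγ : Continuous γ) (hinj : Function.Injective γ) :
    Topology.IsEmbedding fun t => ({γ t} : NonemptyCompacts X) :=
  (NonemptyCompacts.isometry_singleton.isEmbedding).comp
    (hγ.isClosedEmbedding hinj).isEmbedding

lemma not_isTotallyDisconnected_of_isEmbedding {Y : Type*} [TopologicalSpace Y] {s : Set Y}
    {φ : unitInterval → Y} (hφ : Topology.IsEmbedding φ) (hs : Set.range φ ⊆ s) :
    ¬ IsTotallyDisconnected s := fun h =>
  zero_ne_one (hφ.injective (h _ hs (isPreconnected_range hφ.continuous) ⟨0, rfl⟩ ⟨1, rfl⟩))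

/-- There exist a dendrite `D` (a nontrivial compact connected locally connected
metric space containing no subset homeomorphic to the circle), a continuous
topologically transitive map `f : D → D`, and a topological embedding
`φ : [0,1] → 2^D` whose image is contained in the hyperspace of ω-limit sets
`ω(f)`.  In particular, `ω(f)` contains an arc and is not totally disconnected. -/
theorem exists_dendrite_transitive_omegaHyperspace_contains_arc :
    ∃ (D : Type) (_ : MetricSpace D) (f : D → D)
      (φ : unitInterval → NonemptyCompacts D),
      CompactSpace D ∧ ConnectedSpace D ∧ LocallyConnectedSpace D ∧ Nontrivial D ∧
      (¬ ∃ S : Set D, Nonempty (S ≃ₜ Circle)) ∧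
      Continuous f ∧ TopTransitive f ∧
      Topology.IsEmbedding φ ∧
      Set.range φ ⊆ omegaHyperspace f ∧
      ¬ IsTotallyDisconnected (omegaHyperspace f) := by
  let := metrizableSpaceMetric (hairyTree zigzag)
  have hφ := isEmbedding_singleton_comp (HairDynamics.continuous_spine (q := zigzag))
    HairDynamics.spine_injective
  have hω : Set.range (fun t => ({HairDynamics.spine zigzag t} : NonemptyCompacts _)) ⊆
      omegaHyperspace zigzagDynamics.map := by
    rintro _ ⟨t, rfl⟩
    exact ⟨HairDynamics.spine zigzag t, by
      rw [omegaLimitSet_of_fixed (zigzagDynamics.map_spine t)]; rfl⟩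
  refine ⟨hairyTree zigzag, inferInstance, zigzagDynamics.map, _, inferInstance, inferInstance,
    inferInstance, HairDynamics.spine_injective.nontrivial, hairyTree.not_homeomorph_circle,
    zigzagDynamics.continuous_map, fun U V hU hV hUne hVne => ?_, hφ, hω,
    not_isTotallyDisconnected_of_isEmbedding hφ hω⟩
  obtain ⟨n, hn, h⟩ := zigzagDynamics.exists_iterate_image_eq_univ hU hUne
  exact ⟨n, hn, by rwa [h, Set.univ_inter]⟩
end
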